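/- Assume r ≥ 2. Let t be a positive integer with 2t < 3d, and let f be a nonzero homogeneous polynomial of degree d in x_0,…,x_r over K with sr(f) = t. If there exist two decompositions A, B ∈ S(f) that are not identified (i.e., some form of A is not proportional to any form of B), then S(f) is infinite: there are infinitely many pairwise non-identified decompositions of f. -/

import Mathlib

open MvPolynomial

/-- The degree-`d` power of (a representative linear form of) a point of `ℙ^r`,
regarded as a homogeneous polynomial of degree `d` in `x_0, …, x_r`. -/
noncomputable def powForm (K : Type) [Field K] (r d : ℕ)
    (p : Projectivization K (Fin (r + 1) → K)) : MvPolynomial (Fin (r + 1)) K :=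
  (∑ i, MvPolynomial.C (p.rep i) * MvPolynomial.X i) ^ d

/-- The span of the `d`-th powers of the linear forms corresponding to a set of
points of `ℙ^r`. -/
noncomputable def decompSpan (K : Type) [Field K] (r d : ℕ)
    (S : Set (Projectivization K (Fin (r + 1) → K))) :
    Submodule K (MvPolynomial (Fin (r + 1)) K) :=
  Submodule.span K (powForm K r d '' S)

/-- The symmetric rank of `f`. -/
noncomputable def symRank (K : Type) [Field K] (r d : ℕ)
    (f : MvPolynomial (Fin (r + 1)) K) : ℕ :=
  sInf {n | ∃ A : Finset (Projectivization K (Fin (r + 1) → K)),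
    A.card = n ∧ f ∈ decompSpan K r d ↑A}

/-- `S(f)`: the set of decompositions of `f`, i.e. finite sets of points of `ℙ^r`
computing the symmetric rank of `f`. -/
def decompSet (K : Type) [Field K] (r d : ℕ) (f : MvPolynomial (Fin (r + 1)) K) :
    Set (Finset (Projectivization K (Fin (r + 1) → K))) :=
  {A | f ∈ decompSpan K r d ↑A ∧ A.card = symRank K r d f}

/-- The points of `ℙ^r` lying on the hypersurface `Z(q)`. -/
def projZeros (K : Type) [Field K] (r : ℕ) (q : MvPolynomial (Fin (r + 1)) K) :
    Set (Projectivization K (Fin (r + 1) → K)) :=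
  {p | MvPolynomial.eval p.rep q = 0}

/-- A line of `ℙ^r`. -/
def IsProjLine (K : Type) [Field K] (r : ℕ)
    (L : Set (Projectivization K (Fin (r + 1) → K))) : Prop :=
  ∃ W : Submodule K (Fin (r + 1) → K), Module.finrank K W = 2 ∧
    L = {p | p.rep ∈ W}

/-- A smooth conic of `ℙ^r`. -/
def IsSmoothConic (K : Type) [Field K] (r : ℕ)
    (C : Set (Projectivization K (Fin (r + 1) → K))) : Prop :=
  ∃ u v w : Fin (r + 1) → K, LinearIndependent K ![u, v, w] ∧
    C = {p | ∃ s t : K, (s ≠ 0 ∨ t ≠ 0) ∧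
      p.submodule = Submodule.span K {s ^ 2 • u + (s * t) • v + t ^ 2 • w}}

section Univariate
open Polynomial

/-- A pencil `P + λ G` through a polynomial `P` with simple roots has simple roots for all but
finitely many `λ`. -/
theorem finite_setOf_not_pencil_eq_prod {K : Type*} [Field K] [IsAlgClosed K]
    (Y : Finset K) (G : K[X]) (hG : G ≠ 0) (hdeg : G.degree < Y.card) :
    {l : K | ¬ ∃ Y' : Finset K, Y'.card = Y.card ∧
      ∏ y ∈ Y', (Polynomial.X - Polynomial.C y) = ∏ y ∈ Y, (Polynomial.X - Polynomial.C y) + Polynomial.C l * G}.Finite := by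
  classical
  set P : K[X] := ∏ y ∈ Y, (Polynomial.X - Polynomial.C y) with hP
  have hPm : P.Monic := monic_prod_X_sub_C _ _
  have hPd : P.degree = Y.card := by
    rw [hP, degree_prod]; simp
  have hPsep : P.Separable := separable_prod_X_sub_C_iff'.2 (by simp)
  set W : K[X] := P * derivative G - derivative P * G with hW
  have hW0 : W ≠ 0 := by
    intro h0
    have h1 : P ∣ derivative P * G := ⟨derivative G, by rw [hW, sub_eq_zero] at h0; exact h0.symm⟩
    have h2 : P ∣ G := (hPsep : IsCoprime P (derivative P)).dvd_of_dvd_mul_left h1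
    exact absurd (degree_le_of_dvd h2 hG) (by rw [hPd]; exact not_le.2 hdeg)
  have hfin : {l : K | ∃ x, Polynomial.eval x P + l * Polynomial.eval x G = 0 ∧
      Polynomial.eval x (derivative P) + l * Polynomial.eval x (derivative G) = 0}.Finite := by
    refine (W.roots.toFinset.finite_toSet.biUnion
      (t := fun x => {l : K | Polynomial.eval x P + l * Polynomial.eval x G = 0 ∧
      Polynomial.eval x (derivative P) + l * Polynomial.eval x (derivative G) = 0}) ?_).subset ?_
    · intro x _
      refine Set.Subsingleton.finite ?_
      rintro l ⟨h1, h2⟩ l' ⟨h1', h2'⟩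
      by_contra hne
      have hll : l - l' ≠ 0 := sub_ne_zero.2 hne
      have e1 : Polynomial.eval x G = 0 := by
        have : (l - l') * Polynomial.eval x G = 0 := by linear_combination h1 - h1'
        exact (mul_eq_zero.1 this).resolve_left hll
      have e2 : Polynomial.eval x (derivative G) = 0 := by
        have : (l - l') * Polynomial.eval x (derivative G) = 0 := by linear_combination h2 - h2'
        exact (mul_eq_zero.1 this).resolve_left hll
      rw [e1] at h1
      rw [e2] at h2
      obtain ⟨u, v, huv⟩ := hPsep
      have := congrArg (Polynomial.eval x) huv
      simp only [Polynomial.eval_add, Polynomial.eval_mul, Polynomial.eval_one] at this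
      simp only [mul_zero, add_zero] at h1 h2
      rw [h1, h2] at this
      simp at this
    · rintro l ⟨x, h1, h2⟩
      simp only [Set.mem_iUnion]
      refine ⟨x, ?_, h1, h2⟩
      rw [Finset.mem_coe, Multiset.mem_toFinset, mem_roots hW0, IsRoot.def, hW,
        Polynomial.eval_sub, Polynomial.eval_mul, Polynomial.eval_mul]
      linear_combination (Polynomial.eval x (derivative G)) * h1 - (Polynomial.eval x G) * h2
  refine hfin.subset ?_
  intro l hl
  by_contra hbad
  apply hl
  set g : K[X] := P + Polynomial.C l * G with hg
  have hlt : (Polynomial.C l * G).degree < P.degree := by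
    rw [hPd]
    refine lt_of_le_of_lt ?_ hdeg
    by_cases h : l = 0
    · simp [h]
    · rw [degree_C_mul h]
  have hgm : g.Monic := hPm.add_of_left hlt
  have hgd : g.natDegree = Y.card := by
    apply natDegree_eq_of_degree_eq_some
    rw [hg, degree_add_eq_left_of_degree_lt hlt, hPd]
  have hgsep : g.Separable := by
    rw [separable_def]
    by_contra hc
    apply hbad
    obtain ⟨x, hx⟩ : ∃ x, g.eval x = 0 ∧ (derivative g).eval x = 0 := by
      by_contra hno
      push Not at hno
      apply hc
      rw [isCoprime_iff_aeval_ne_zero_of_isAlgClosed K K]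
      intro a
      by_cases h : g.eval a = 0
      · right; simpa using hno a h
      · left; simpa using h
    exact ⟨x, by simpa [hg] using hx.1, by simpa [hg] using hx.2⟩
  have hsplit := IsAlgClosed.splits g
  have hnd := nodup_roots hgsep
  refine ⟨g.roots.toFinset, ?_, ?_⟩
  · rw [Multiset.toFinset_card_of_nodup hnd, ← hgd]
    exact hsplit.natDegree_eq_card_roots.symm
  · rw [Finset.prod, Multiset.toFinset_val, hnd.dedup]
    exact (hsplit.eq_prod_roots_of_monic hgm).symm

/-- A functional killing the multiples of `∏ (Polynomial.X - y)` of degree at most `m` is a combination of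
evaluations in degree at most `m`. -/
theorem exists_eq_sum_eval_of_prod {K : Type*} [Field K] (m : ℕ) (L : K[X] →ₗ[K] K)
    (Y : Finset K)
    (hL : ∀ h : K[X], h ≠ 0 → h.natDegree + Y.card ≤ m → L ((∏ y ∈ Y, (Polynomial.X - Polynomial.C y)) * h) = 0) :
    ∃ b : K → K, ∀ q : K[X], q.natDegree ≤ m → L q = ∑ y ∈ Y, b y * q.eval y := by
  classical
  set g : K[X] := ∏ y ∈ Y, (Polynomial.X - Polynomial.C y) with hg
  have hgm : g.Monic := monic_prod_X_sub_C _ _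
  have hgn : g.natDegree = Y.card := by rw [hg, natDegree_prod_of_monic]; simp; intro i _; exact monic_X_sub_C i
  refine ⟨fun y => L (Lagrange.basis Y id y), fun q hq => ?_⟩
  have h1 : q %ₘ g = Lagrange.interpolate Y id (fun y => q.eval y) := by
    apply Lagrange.eq_interpolate_of_eval_eq _ (Set.injOn_id _)
    · have := degree_modByMonic_lt q hgm
      rwa [degree_eq_natDegree hgm.ne_zero, hgn] at this
    · intro y hy
      have hd := congrArg (Polynomial.eval y) (modByMonic_add_div q g)
      have h0 : Polynomial.eval y g = 0 := by
        rw [hg, Polynomial.eval_prod]; exact Finset.prod_eq_zero hy (by simp)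
      simpa [h0] using hd
  have h2 : L (g * (q /ₘ g)) = 0 := by
    by_cases h0 : q /ₘ g = 0
    · simp [h0]
    · apply hL _ h0
      have h3 := natDegree_divByMonic q hgm
      have : ¬ q.degree < g.degree := fun h => h0 ((divByMonic_eq_zero_iff hgm).2 h)
      have h4 : g.natDegree ≤ q.natDegree := natDegree_le_natDegree (not_lt.1 this)
      omega
  conv_lhs => rw [← modByMonic_add_div q g]
  rw [map_add, h2, add_zero, h1, Lagrange.interpolate_apply, map_sum]
  refine Finset.sum_congr rfl fun y _ => ?_
  rw [← Polynomial.smul_eq_C_mul, map_smul, smul_eq_mul, mul_comm]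

theorem exists_ne_zero_functional_mul_eq_zero {K : Type*} [Field K] (m s : ℕ)
    (hs : m + 2 ≤ 2 * s) (L : K[X] →ₗ[K] K) :
    ∃ G : K[X], G ≠ 0 ∧ G.degree < s ∧ ∀ h : K[X], h.natDegree + s ≤ m → L (G * h) = 0 := by
  let T : degreeLT K s →ₗ[K] (Fin (m + 1 - s) → K) :=
    LinearMap.pi fun j => L ∘ₗ (LinearMap.mulRight K (Polynomial.X ^ (j : ℕ))) ∘ₗ (degreeLT K s).subtype
  have hlt : Module.finrank K (Fin (m + 1 - s) → K) < Module.finrank K (degreeLT K s) := by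
    rw [Module.finrank_fin_fun, (degreeLTEquiv K s).finrank_eq, Module.finrank_fin_fun]
    omega
  have : FiniteDimensional K (degreeLT K s) := (degreeLTEquiv K s).symm.finiteDimensional
  have hk := LinearMap.ker_ne_bot_of_finrank_lt (f := T) hlt
  obtain ⟨G, hGk, hG0⟩ := (Submodule.ne_bot_iff _).1 hk
  refine ⟨G, by simpa using hG0, mem_degreeLT.1 G.2, fun h hh => ?_⟩
  conv_lhs => rw [h.as_sum_range_C_mul_X_pow]
  rw [Finset.mul_sum, map_sum]
  refine Finset.sum_eq_zero fun j hj => ?_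
  have hj' : j < m + 1 - s := by
    rw [Finset.mem_range] at hj; omega
  have := congrFun (LinearMap.mem_ker.1 hGk) ⟨j, hj'⟩
  rw [mul_left_comm, ← Polynomial.smul_eq_C_mul, map_smul]
  have h2 : L ((G : K[X]) * Polynomial.X ^ j) = 0 := this
  rw [h2, smul_zero]

/-- The functional `q ↦ ∑ a y * q(y)`. -/
noncomputable def evalSum {K : Type*} [Field K] (Y : Finset K) (a : K → K) : K[X] →ₗ[K] K :=
  ∑ y ∈ Y, a y • leval y

theorem evalSum_apply {K : Type*} [Field K] (Y : Finset K) (a : K → K) (q : K[X]) :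
    evalSum Y a q = ∑ y ∈ Y, a y * q.eval y := by
  simp [evalSum, leval]

theorem evalSum_prod_mul {K : Type*} [Field K] (Y : Finset K) (a : K → K) (h : K[X]) :
    evalSum Y a ((∏ y ∈ Y, (Polynomial.X - Polynomial.C y)) * h) = 0 := by
  rw [evalSum_apply]
  refine Finset.sum_eq_zero fun y hy => ?_
  rw [Polynomial.eval_mul, Polynomial.eval_prod, Finset.prod_eq_zero hy (by simp)]
  simp

theorem infinite_evalSum_representations {K : Type*} [Field K] [IsAlgClosed K] (m : ℕ)
    (Y : Finset K) (a : K → K) (hs : m + 2 ≤ 2 * Y.card) :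
    {Y' : Finset K | Y'.card = Y.card ∧ ∃ b : K → K, ∀ q : K[X], q.natDegree ≤ m →
      ∑ y ∈ Y, a y * q.eval y = ∑ y ∈ Y', b y * q.eval y}.Infinite := by
  obtain ⟨G, hG0, hGd, hG⟩ := exists_ne_zero_functional_mul_eq_zero m Y.card hs (evalSum Y a)
  have hfin := finite_setOf_not_pencil_eq_prod Y G hG0 hGd
  have hinf := hfin.infinite_compl
  have hmem : ∀ l ∈ {l : K | ¬ ∃ Y' : Finset K, Y'.card = Y.card ∧
      ∏ y ∈ Y', (Polynomial.X - Polynomial.C y) = ∏ y ∈ Y, (Polynomial.X - Polynomial.C y) + Polynomial.C l * G}ᶜ, ∃ Y' : Finset K,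
      Y'.card = Y.card ∧ ∏ y ∈ Y', (Polynomial.X - Polynomial.C y) = ∏ y ∈ Y, (Polynomial.X - Polynomial.C y) + Polynomial.C l * G := by
    intro l hl
    simpa using hl
  choose! Φ hΦ1 hΦ2 using hmem
  refine (hinf.image (f := Φ) ?_).mono ?_
  · intro l hl l' hl' hll
    have := hΦ2 l hl
    rw [hll, hΦ2 l' hl', add_right_inj] at this
    exact (Polynomial.C_injective (mul_right_cancel₀ hG0 this)).symm
  · rintro _ ⟨l, hl, rfl⟩
    refine ⟨hΦ1 l hl, ?_⟩
    obtain ⟨b, hb⟩ := exists_eq_sum_eval_of_prod m (evalSum Y a) (Φ l) (by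
      intro h _ hh
      rw [hΦ2 l hl, add_mul, map_add, evalSum_prod_mul, mul_assoc, ← Polynomial.smul_eq_C_mul, map_smul,
        hG h (by rw [← hΦ1 l hl]; exact hh)]
      simp)
    exact ⟨b, fun q hq => by rw [← hb q hq, evalSum_apply]⟩

theorem finite_setOf_not_pencil_representation {K : Type*} [Field K] [IsAlgClosed K] (m : ℕ)
    (Y Z : Finset K) (a b : K → K) (μ : K) (hm : m + 1 = 2 * Y.card) (hYZ : Z.card = Y.card)
    (hne : Y ≠ Z)
    (hrel : ∀ q : K[X], q.natDegree ≤ m →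
      ∑ y ∈ Y, a y * q.eval y - ∑ y ∈ Z, b y * q.eval y = μ * q.coeff m) :
    {l : K | ¬ ∃ Y' : Finset K, Y'.card = Y.card ∧
      ∏ y ∈ Y', (Polynomial.X - Polynomial.C y) = ∏ y ∈ Y, (Polynomial.X - Polynomial.C y) +
        Polynomial.C l * (∏ y ∈ Z, (Polynomial.X - Polynomial.C y) - ∏ y ∈ Y, (Polynomial.X - Polynomial.C y)) ∧
      ∃ b' : K → K, ∀ q : K[X], q.natDegree ≤ m →
        ∑ y ∈ Y, a y * q.eval y = ∑ y ∈ Y', b' y * q.eval y + l * μ * q.coeff m}.Finite ∧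
    ∏ y ∈ Z, (Polynomial.X - Polynomial.C y) - ∏ y ∈ Y, (Polynomial.X - Polynomial.C y) ≠ (0 : K[X]) := by
  classical
  set P : K[X] := ∏ y ∈ Y, (Polynomial.X - Polynomial.C y) with hP
  set Q : K[X] := ∏ y ∈ Z, (Polynomial.X - Polynomial.C y) with hQ
  have hPm : P.Monic := monic_prod_X_sub_C _ _
  have hQm : Q.Monic := monic_prod_X_sub_C _ _
  have hPd : P.degree = Y.card := by rw [hP, degree_prod]; simp
  have hQd : Q.degree = Y.card := by rw [hQ, degree_prod, ← hYZ]; simp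
  have hG0 : Q - P ≠ 0 := by
    intro h
    apply hne
    have h1 : P.roots = Y.val := by rw [hP]; exact roots_prod_X_sub_C Y
    have h2 : Q.roots = Z.val := by rw [hQ]; exact roots_prod_X_sub_C Z
    rw [sub_eq_zero] at h
    rw [h, h1] at h2
    exact Finset.val_injective h2
  have hGd : (Q - P).degree < Y.card := by
    rw [← hQd]
    exact degree_sub_lt_left (by rw [hQd, hPd]) hQm.ne_zero (by rw [hQm.leadingCoeff, hPm.leadingCoeff])
  refine ⟨(finite_setOf_not_pencil_eq_prod Y (Q - P) hG0 hGd).subset ?_, hG0⟩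
  intro l hl hex
  apply hl
  obtain ⟨Y', hY', hprod⟩ := hex
  refine ⟨Y', hY', hprod, ?_⟩
  have hcard : ∀ h : K[X], h.natDegree + Y'.card ≤ m → Q.natDegree + h.natDegree ≤ m := by
    intro h hh
    rw [natDegree_eq_of_degree_eq_some hQd]; omega
  obtain ⟨b', hb'⟩ := exists_eq_sum_eval_of_prod m (evalSum Y a - (l * μ) • lcoeff K m) Y' (by
    intro h _ hh
    have hs : 0 < Y.card := by omega
    have hY'm : (∏ y ∈ Y', (Polynomial.X - Polynomial.C y) : K[X]).Monic := monic_prod_X_sub_C _ _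
    have hY'n : (∏ y ∈ Y', (Polynomial.X - Polynomial.C y) : K[X]).natDegree = Y.card := by
      rw [natDegree_prod_of_monic _ _ fun i _ => monic_X_sub_C i]; simp [hY']
    have hc : ∀ R : K[X], R.Monic → R.natDegree = Y.card →
        (R * h).coeff m = h.coeff (Y.card - 1) := by
      intro R hR hRn
      have : m = R.natDegree + (Y.card - 1) := by omega
      rw [this, coeff_mul_add_eq_of_natDegree_le le_rfl (by omega), hR.coeff_natDegree, one_mul]
    have h1 : evalSum Y a (Q * h) = μ * h.coeff (Y.card - 1) := by
      have h2 := hrel (Q * h) (natDegree_mul_le.trans (hcard h hh))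
      have h3 := evalSum_prod_mul Z b h
      rw [evalSum_apply, ← hQ] at h3
      rw [h3, sub_zero, hc Q hQm (natDegree_eq_of_degree_eq_some hQd)] at h2
      rw [evalSum_apply, h2]
    have h0 : evalSum Y a (P * h) = 0 := evalSum_prod_mul Y a h
    rw [LinearMap.sub_apply, LinearMap.smul_apply, Polynomial.lcoeff_apply, hc _ hY'm hY'n, hprod,
      add_mul, map_add, h0, mul_assoc, ← Polynomial.smul_eq_C_mul, map_smul, sub_mul, map_sub, h0, h1]
    simp only [smul_eq_mul]
    ring)
  refine ⟨b', fun q hq => ?_⟩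
  rw [← hb' q hq, ← evalSum_apply]
  simp

end Univariate

section CayleyBacharach

variable {K V ι : Type*} [Field K] [AddCommGroup V] [Module K V]

/-- The Cayley–Bacharach condition: a relation with nowhere vanishing coefficients on `Γ` between
the evaluations at the points `x i` of all products of `d` linear forms. -/
def CayleyBacharach (K : Type*) {V ι : Type*} [Field K] [AddCommGroup V] [Module K V]
    (x : ι → V) (d : ℕ) (Γ : Finset ι) : Prop :=
  ∃ c : ι → K, (∀ i ∈ Γ, c i ≠ 0) ∧ ∀ L : List (Module.Dual K V), L.length = d →
    ∑ i ∈ Γ, c i * (L.map fun l => l (x i)).prod = 0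

open Classical in
theorem CayleyBacharach.mul_linear {x : ι → V} {d : ℕ} {Γ : Finset ι}
    (h : CayleyBacharach K x (d + 1) Γ) (l : Module.Dual K V) :
    CayleyBacharach K x d (Γ.filter fun i => l (x i) ≠ 0) := by
  obtain ⟨c, hc, hrel⟩ := h
  refine ⟨fun i => c i * l (x i), fun i hi => ?_, fun L hL => ?_⟩
  · rw [Finset.mem_filter] at hi
    exact mul_ne_zero (hc i hi.1) hi.2
  · refine Eq.trans ?_ (hrel (l :: L) (by simp [hL]))
    rw [Finset.sum_filter]
    refine Finset.sum_congr rfl fun i _ => ?_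
    by_cases h0 : l (x i) = 0
    · simp [h0]
    · simp [h0, mul_assoc]

open Classical in
theorem CayleyBacharach.mul_bilin [FiniteDimensional K V] {x : ι → V} {d : ℕ} {Γ : Finset ι}
    (h : CayleyBacharach K x (d + 2) Γ) (B : LinearMap.BilinForm K V) :
    CayleyBacharach K x d (Γ.filter fun i => B (x i) (x i) ≠ 0) := by
  obtain ⟨c, hc, hrel⟩ := h
  refine ⟨fun i => c i * B (x i) (x i), fun i hi => ?_, fun L hL => ?_⟩
  · rw [Finset.mem_filter] at hi
    exact mul_ne_zero (hc i hi.1) hi.2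
  · let e := Module.finBasis K V
    have hB : ∀ v, B v v = ∑ k, e.coord k v * B (e k) v := by
      intro v
      conv_lhs => rw [← e.sum_repr v]
      simp only [map_sum, map_smul, LinearMap.sum_apply, LinearMap.smul_apply, smul_eq_mul]
      simp_rw [Finset.mul_sum]
      rw [Finset.sum_comm]
      refine Finset.sum_congr rfl fun k _ => ?_
      conv_rhs => rw [← e.sum_repr v]
      simp only [map_sum, map_smul, smul_eq_mul, Finset.mul_sum]
      refine Finset.sum_congr rfl fun j _ => ?_
      simp [Finsupp.single_apply]
      ring
    have : ∑ i ∈ Γ, c i * B (x i) (x i) * (L.map fun l => l (x i)).prod =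
        ∑ k, ∑ i ∈ Γ, c i * ((e.coord k :: B (e k) :: L).map fun l => l (x i)).prod := by
      rw [Finset.sum_comm]
      refine Finset.sum_congr rfl fun i _ => ?_
      rw [hB, Finset.mul_sum, Finset.sum_mul]
      refine Finset.sum_congr rfl fun k _ => ?_
      simp only [List.map_cons, List.prod_cons]
      ring
    rw [Finset.sum_filter]
    trans ∑ i ∈ Γ, c i * B (x i) (x i) * (L.map fun l => l (x i)).prod
    · refine Finset.sum_congr rfl fun i _ => ?_
      by_cases h0 : B (x i) (x i) = 0
      · simp [h0]
      · simp [h0]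
    · rw [this]
      exact Finset.sum_eq_zero fun k _ => hrel _ (by simp [hL])

theorem exists_dual_vanishing_ne_zero [Infinite K] (x : ι → V) (Γ : Finset ι)
    (W : Submodule K V) :
    ∃ l : Module.Dual K V, (∀ w ∈ W, l w = 0) ∧ ∀ i ∈ Γ, x i ∉ W → l (x i) ≠ 0 := by
  obtain ⟨f, hf⟩ := Module.exists_dual_forall_apply_ne_zero (K := K)
    (v := fun i : {i : Γ // x i ∉ W} => W.mkQ (x i)) (fun i => by
      simpa using i.2)
  refine ⟨f ∘ₗ W.mkQ, fun w hw => ?_, fun i hi hiW => hf ⟨⟨i, hi⟩, hiW⟩⟩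
  rw [LinearMap.comp_apply, Submodule.mkQ_apply, (Submodule.Quotient.mk_eq_zero W).2 hw, map_zero]

open Classical in
theorem CayleyBacharach.diff [Infinite K] {x : ι → V} {d : ℕ} {Γ : Finset ι}
    (h : CayleyBacharach K x (d + 1) Γ) (W : Submodule K V) :
    CayleyBacharach K x d (Γ.filter fun i => x i ∉ W) := by
  obtain ⟨l, hl, hl'⟩ := exists_dual_vanishing_ne_zero x Γ W
  have : (Γ.filter fun i => x i ∉ W) = Γ.filter fun i => l (x i) ≠ 0 := by
    refine Finset.filter_congr fun i hi => ⟨hl' i hi, fun h1 h2 => h1 (hl _ h2)⟩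
  rw [this]
  exact h.mul_linear l

open Classical in
theorem card_filter_mem_add_card_filter_notMem (x : ι → V) (Γ : Finset ι) (W : Submodule K V) :
    (Γ.filter fun i => x i ∈ W).card + (Γ.filter fun i => x i ∉ W).card = Γ.card :=
  Finset.card_filter_add_card_filter_not _

theorem CayleyBacharach.add_two_le_card [Infinite K] {x : ι → V}
    (hx : ∀ i, x i ≠ 0) (hinj : ∀ i j, x j ∈ Submodule.span K {x i} → j = i) {d : ℕ}
    {Γ : Finset ι} (h : CayleyBacharach K x d Γ) (hne : Γ.Nonempty) : d + 2 ≤ Γ.card := by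
  classical
  have hone : ∀ d, ∀ i, ¬ CayleyBacharach K x d {i} := by
    rintro d i ⟨c, hc, hrel⟩
    obtain ⟨l, -, hl⟩ := exists_dual_vanishing_ne_zero x {i} (⊥ : Submodule K V)
    have h1 := hl i (by simp) (by simpa using hx i)
    have h2 := hrel (List.replicate d l) (by simp)
    have h3 := hc i (by simp)
    simp [h1, h3] at h2
  induction d generalizing Γ with
  | zero =>
    by_contra hlt
    have : Γ.card = 1 := by have := hne.card_pos; omega
    obtain ⟨i, rfl⟩ := Finset.card_eq_one.1 this
    exact hone _ _ h
  | succ d ih =>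
    obtain ⟨i, hi⟩ := hne
    by_cases hj : ∃ j ∈ Γ, j ≠ i
    · obtain ⟨j, hj, hji⟩ := hj
      have h1 := ih (h.diff (Submodule.span K {x i})) ⟨j, by
        rw [Finset.mem_filter]; exact ⟨hj, fun h => hji (hinj i j h)⟩⟩
      have h2 : (Γ.filter fun k => x k ∉ Submodule.span K {x i}).card < Γ.card := by
        apply Finset.card_lt_card
        refine Finset.filter_ssubset.2 ⟨i, hi, ?_⟩
        simp
      omega
    · push Not at hj
      have : Γ = {i} := Finset.eq_singleton_iff_unique_mem.2 ⟨hi, hj⟩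
      exact absurd (this ▸ h) (hone _ _)

theorem finrank_span_pair_le (u v : V) : Module.finrank K (Submodule.span K {u, v}) ≤ 2 := by
  have h : Module.finrank K (Submodule.span K (Set.range ![u, v])) ≤ 2 :=
    (finrank_range_le_card (R := K) ![u, v]).trans (by simp)
  rwa [Matrix.range_cons_cons_empty] at h

theorem finrank_span_triple_le (u v w : V) :
    Module.finrank K (Submodule.span K {u, v, w}) ≤ 3 := by
  have h : Module.finrank K (Submodule.span K (Set.range ![u, v, w])) ≤ 3 :=
    (finrank_range_le_card (R := K) ![u, v, w]).trans (by simp)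
  rwa [Matrix.range_cons, Matrix.range_cons_cons_empty, Set.singleton_union] at h

theorem CayleyBacharach.subset_line [Infinite K] {x : ι → V}
    (hx : ∀ i, x i ≠ 0) (hinj : ∀ i j, x j ∈ Submodule.span K {x i} → j = i) {d : ℕ}
    {Γ : Finset ι} (h : CayleyBacharach K x d Γ) (hcard : Γ.card ≤ 2 * d + 1) :
    ∃ W : Submodule K V, Module.finrank K W ≤ 2 ∧ ∀ i ∈ Γ, x i ∈ W := by
  classical
  induction d generalizing Γ with
  | zero =>
    rcases Γ.eq_empty_or_nonempty with rfl | hne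
    · exact ⟨⊥, by simp, by simp⟩
    · have := h.add_two_le_card hx hinj hne
      omega
  | succ d ih =>
    rcases Γ.eq_empty_or_nonempty with rfl | hne
    · exact ⟨⊥, by simp, by simp⟩
    have hc := h.add_two_le_card hx hinj hne
    obtain ⟨i, hi, j, hj, hij⟩ := Finset.one_lt_card.1 (show 1 < Γ.card by omega)
    let W : Submodule K V := Submodule.span K {x i, x j}
    have h2 : 2 ≤ (Γ.filter fun k => x k ∈ W).card := by
      rw [← Finset.card_pair hij]
      apply Finset.card_le_card
      intro k hk
      rw [Finset.mem_insert, Finset.mem_singleton] at hk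
      rw [Finset.mem_filter]
      rcases hk with rfl | rfl
      · exact ⟨hi, Submodule.subset_span (by simp)⟩
      · exact ⟨hj, Submodule.subset_span (by simp)⟩
    have h3 := card_filter_mem_add_card_filter_notMem x Γ W
    obtain ⟨W', hW', hsub⟩ := ih (h.diff W) (by omega)
    rcases (Γ.filter fun k => x k ∉ W).eq_empty_or_nonempty with h0 | h0
    · refine ⟨W, finrank_span_pair_le _ _, fun k hk => ?_⟩
      simpa using Finset.filter_eq_empty_iff.1 h0 hk
    · have h4 := (h.diff W).add_two_le_card hx hinj h0
      have h5 : (Γ.filter fun k => x k ∉ W).card ≤ (Γ.filter fun k => x k ∈ W').card := by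
        apply Finset.card_le_card
        intro k hk
        rw [Finset.mem_filter]
        exact ⟨(Finset.mem_filter.1 hk).1, hsub k hk⟩
      have h6 := card_filter_mem_add_card_filter_notMem x Γ W'
      refine ⟨W', hW', ?_⟩
      by_contra hcon
      push Not at hcon
      obtain ⟨k, hk, hkW⟩ := hcon
      have h7 := (h.diff W').add_two_le_card hx hinj ⟨k, Finset.mem_filter.2 ⟨hk, hkW⟩⟩
      omega

end CayleyBacharach

section HilbertFunction

variable {K κ : Type*} [Field K]

theorem finrank_map_add_finrank_inf_ker {V W : Type*} [AddCommGroup V] [Module K V]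
    [AddCommGroup W] [Module K W] (φ : V →ₗ[K] W) (D : Submodule K V) [FiniteDimensional K D] :
    Module.finrank K (D.map φ) + Module.finrank K (D ⊓ LinearMap.ker φ : Submodule K V) =
      Module.finrank K D := by
  rw [← LinearMap.finrank_range_add_finrank_ker (φ.domRestrict D), LinearMap.range_domRestrict,
    LinearMap.ker_domRestrict]
  congr 1
  rw [← Submodule.map_comap_subtype]
  exact Submodule.finrank_map_subtype_eq D _

/-- The functions on `κ` that are polynomials of degree at most `k` in `X` and `Y`. -/
def polyFun (X Y : κ → K) (k : ℕ) : Submodule K (κ → K) :=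
  Submodule.span K {g | ∃ a b, a + b ≤ k ∧ g = X ^ a * Y ^ b}

theorem polyFun_mono (X Y : κ → K) {j k : ℕ} (h : j ≤ k) : polyFun X Y j ≤ polyFun X Y k :=
  Submodule.span_mono fun _ ⟨a, b, hab, hg⟩ => ⟨a, b, hab.trans h, hg⟩

theorem monomial_mem_polyFun (X Y : κ → K) {a b k : ℕ} (h : a + b ≤ k) :
    X ^ a * Y ^ b ∈ polyFun X Y k :=
  Submodule.subset_span ⟨a, b, h, rfl⟩

theorem mul_mem_polyFun (X Y : κ → K) {j k : ℕ} {g h : κ → K} (hg : g ∈ polyFun X Y j)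
    (hh : h ∈ polyFun X Y k) : g * h ∈ polyFun X Y (j + k) := by
  induction hg using Submodule.span_induction with
  | mem g hg =>
    obtain ⟨a, b, hab, rfl⟩ := hg
    induction hh using Submodule.span_induction with
    | mem h hh =>
      obtain ⟨a', b', hab', rfl⟩ := hh
      have : X ^ a * Y ^ b * (X ^ a' * Y ^ b') = X ^ (a + a') * Y ^ (b + b') := by ring
      rw [this]
      exact monomial_mem_polyFun X Y (by omega)
    | zero => simp
    | add h h' _ _ ih ih' => rw [mul_add]; exact Submodule.add_mem _ ih ih'
    | smul t h _ ih => rw [mul_smul_comm]; exact Submodule.smul_mem _ _ ih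
  | zero => simp
  | add h h' _ _ ih ih' => rw [add_mul]; exact Submodule.add_mem _ ih ih'
  | smul t h _ ih => rw [smul_mul_assoc]; exact Submodule.smul_mem _ _ ih

/-- The function defined by the homogenization of a univariate polynomial. -/
noncomputable def homogFun (X Y : κ → K) (m : ℕ) : Polynomial K →ₗ[K] (κ → K) :=
  ∑ j ∈ Finset.range (m + 1), (Polynomial.lcoeff K j).smulRight (X ^ j * Y ^ (m - j))

theorem homogFun_apply (X Y : κ → K) (m : ℕ) (g : Polynomial K) :
    homogFun X Y m g = ∑ j ∈ Finset.range (m + 1), g.coeff j • (X ^ j * Y ^ (m - j)) := by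
  simp [homogFun, LinearMap.sum_apply]

/-- The syzygies in degree `k + 1` modulo functions of degree `k`. -/
noncomputable def leadingForms (X Y : κ → K) (k : ℕ) : Submodule K (Polynomial K) :=
  Polynomial.degreeLT K (k + 2) ⊓ (polyFun X Y k).comap (homogFun X Y (k + 1))

theorem finrank_degreeLT (n : ℕ) : Module.finrank K (Polynomial.degreeLT K n) = n := by
  rw [LinearEquiv.finrank_eq (Polynomial.degreeLTEquiv K n), Module.finrank_fin_fun]

instance (n : ℕ) : FiniteDimensional K (Polynomial.degreeLT K n) :=
  Module.Finite.equiv (Polynomial.degreeLTEquiv K n).symm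

theorem polyFun_succ (X Y : κ → K) (k : ℕ) :
    polyFun X Y (k + 1) =
      polyFun X Y k ⊔ (Polynomial.degreeLT K (k + 2)).map (homogFun X Y (k + 1)) := by
  apply le_antisymm
  · refine Submodule.span_le.2 ?_
    rintro _ ⟨a, b, hab, rfl⟩
    rcases Nat.lt_or_ge (a + b) (k + 1) with h | h
    · exact Submodule.mem_sup_left (monomial_mem_polyFun X Y (by omega))
    · refine Submodule.mem_sup_right ⟨Polynomial.X ^ a, ?_, ?_⟩
      · rw [SetLike.mem_coe, Polynomial.mem_degreeLT, Polynomial.degree_X_pow]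
        exact_mod_cast (by omega : a < k + 2)
      · rw [homogFun_apply, Finset.sum_eq_single a]
        · have : k + 1 - a = b := by omega
          simp [this]
        · intro j _ hj
          simp [Polynomial.coeff_X_pow, hj]
        · intro h1
          exact absurd (Finset.mem_range.2 (by omega)) h1
  · refine sup_le (polyFun_mono X Y (Nat.le_succ k)) ?_
    rintro _ ⟨g, -, rfl⟩
    rw [homogFun_apply]
    refine Submodule.sum_mem _ fun j hj => Submodule.smul_mem _ _ (monomial_mem_polyFun X Y ?_)
    rw [Finset.mem_range] at hj
    omega

theorem finrank_polyFun_succ [Finite κ] (X Y : κ → K) (k : ℕ) :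
    Module.finrank K (polyFun X Y (k + 1)) + Module.finrank K (leadingForms X Y k) =
      Module.finrank K (polyFun X Y k) + (k + 2) := by
  have h1 := finrank_map_add_finrank_inf_ker (polyFun X Y k).mkQ (polyFun X Y (k + 1))
  have h2 := finrank_map_add_finrank_inf_ker
    ((polyFun X Y k).mkQ ∘ₗ homogFun X Y (k + 1)) (Polynomial.degreeLT K (k + 2))
  rw [Submodule.ker_mkQ, inf_eq_right.2 (polyFun_mono X Y (Nat.le_succ k)), polyFun_succ,
    Submodule.map_sup, Submodule.mkQ_map_self, bot_sup_eq, ← polyFun_succ] at h1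
  rw [LinearMap.ker_comp, Submodule.ker_mkQ, finrank_degreeLT, Submodule.map_comp] at h2
  change _ + Module.finrank K (leadingForms X Y k) = _ at h2
  omega

theorem homogFun_succ_of_degree_lt (X Y : κ → K) {m : ℕ} {g : Polynomial K}
    (hg : g ∈ Polynomial.degreeLT K (m + 1)) :
    homogFun X Y (m + 1) g = Y * homogFun X Y m g := by
  rw [Polynomial.mem_degreeLT] at hg
  rw [homogFun_apply, homogFun_apply, Finset.sum_range_succ,
    Polynomial.coeff_eq_zero_of_degree_lt hg, zero_smul, add_zero, Finset.mul_sum]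
  refine Finset.sum_congr rfl fun j hj => ?_
  rw [Finset.mem_range] at hj
  have : m + 1 - j = m - j + 1 := by omega
  rw [this, mul_smul_comm]
  congr 1
  ring

theorem homogFun_succ_X_mul (X Y : κ → K) {m : ℕ} (g : Polynomial K) :
    homogFun X Y (m + 1) (Polynomial.X * g) = X * homogFun X Y m g := by
  rw [homogFun_apply, homogFun_apply, Finset.sum_range_succ', Finset.mul_sum]
  simp only [Polynomial.coeff_X_mul, Polynomial.coeff_X_mul_zero, zero_smul, add_zero]
  refine Finset.sum_congr rfl fun j hj => ?_
  rw [mul_smul_comm, Nat.add_sub_add_right]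
  congr 1
  ring

instance (X Y : κ → K) (k : ℕ) : FiniteDimensional K (leadingForms X Y k) :=
  Submodule.finiteDimensional_of_le (S₂ := Polynomial.degreeLT K (k + 2)) inf_le_left

theorem finrank_leadingForms_lt (X Y : κ → K) {k : ℕ}
    (h : 1 ≤ Module.finrank K (leadingForms X Y k)) :
    Module.finrank K (leadingForms X Y k) < Module.finrank K (leadingForms X Y (k + 1)) := by
  have hX : X ∈ polyFun X Y 1 := by
    simpa using monomial_mem_polyFun X Y (a := 1) (b := 0) le_rfl
  have hY : Y ∈ polyFun X Y 1 := by
    simpa using monomial_mem_polyFun X Y (a := 0) (b := 1) le_rfl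
  have hle : leadingForms X Y k ≤ leadingForms X Y (k + 1) := by
    rintro g ⟨hg, hg'⟩
    refine ⟨Polynomial.degreeLT_mono (by omega) hg, ?_⟩
    rw [SetLike.mem_coe, Submodule.mem_comap, homogFun_succ_of_degree_lt X Y hg]
    exact polyFun_mono X Y (add_comm 1 k).le (mul_mem_polyFun X Y hY hg')
  have hmul : ∀ g ∈ leadingForms X Y k, Polynomial.X * g ∈ leadingForms X Y (k + 1) := by
    rintro g ⟨hg, hg'⟩
    refine ⟨?_, ?_⟩
    · rw [SetLike.mem_coe, Polynomial.mem_degreeLT] at hg ⊢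
      rcases eq_or_ne g 0 with rfl | h0
      · rw [mul_zero, Polynomial.degree_zero]
        exact WithBot.bot_lt_coe _
      · rw [Polynomial.degree_eq_natDegree h0] at hg
        rw [Polynomial.degree_eq_natDegree (mul_ne_zero Polynomial.X_ne_zero h0),
          Polynomial.natDegree_X_mul h0]
        norm_cast at hg ⊢
        omega
    · rw [SetLike.mem_coe, Submodule.mem_comap, homogFun_succ_X_mul]
      exact polyFun_mono X Y (add_comm 1 k).le (mul_mem_polyFun X Y hX hg')
  refine Submodule.finrank_lt_finrank_of_lt (lt_of_le_of_ne hle fun heq => ?_)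
  obtain ⟨g, hg, hg0⟩ := Submodule.exists_mem_ne_zero_of_ne_bot
    (p := leadingForms X Y k) (by rintro hbot; rw [hbot] at h; simp at h)
  have hpow : ∀ n : ℕ, Polynomial.X ^ n * g ∈ leadingForms X Y k := by
    intro n
    induction n with
    | zero => simpa using hg
    | succ n ih => rw [pow_succ', mul_assoc, heq]; exact hmul _ ih
  have h1 := (hpow (k + 2)).1
  rw [SetLike.mem_coe, Polynomial.mem_degreeLT, Polynomial.degree_mul,
    Polynomial.degree_X_pow, Polynomial.degree_eq_natDegree hg0] at h1
  norm_cast at h1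
  omega

theorem finrank_add_finrank_le_of_pairing [Fintype κ] {c : κ → K} (hc : ∀ i, c i ≠ 0)
    {E F : Submodule K (κ → K)} (h : ∀ g ∈ E, ∀ h ∈ F, ∑ i, c i * (g i * h i) = 0) :
    Module.finrank K E + Module.finrank K F ≤ Fintype.card κ := by
  classical
  let Ψ : (κ → K) →ₗ[K] Module.Dual K (κ → K) :=
    LinearMap.mk₂ K (fun g h => ∑ i, c i * (g i * h i))
      (fun g g' h => by rw [← Finset.sum_add_distrib]; simp [add_mul, mul_add])
      (fun t g h => by simp only [smul_eq_mul, Finset.mul_sum, Pi.smul_apply]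
                       exact Finset.sum_congr rfl fun i _ => by ring)
      (fun g h h' => by rw [← Finset.sum_add_distrib]; simp [mul_add])
      (fun t g h => by simp only [smul_eq_mul, Finset.mul_sum, Pi.smul_apply]
                       exact Finset.sum_congr rfl fun i _ => by ring)
  have hΨ : Function.Injective Ψ := by
    refine (injective_iff_map_eq_zero Ψ).2 fun g hg => ?_
    ext i
    have := LinearMap.congr_fun hg (Pi.single i 1)
    simpa [Ψ, Pi.single_apply, hc] using this
  have h1 := LinearEquiv.finrank_eq (Submodule.equivMapOfInjective Ψ hΨ E)
  have h2 : E.map Ψ ≤ F.dualAnnihilator := by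
    rintro _ ⟨g, hg, rfl⟩
    rw [Submodule.mem_dualAnnihilator]
    exact fun w hw => h g hg w hw
  have h3 := Submodule.finrank_mono h2
  have h4 := Subspace.finrank_add_finrank_dualAnnihilator_eq F
  rw [Module.finrank_fintype_fun_eq_card] at h4
  omega

theorem card_le_finrank_of_forall_pairing [Fintype κ] {T : Finset κ} {E : Submodule K (κ → K)}
    (h : ∀ c : κ → K, (∀ g ∈ E, ∑ i ∈ T, c i * g i = 0) → ∀ i ∈ T, c i = 0) :
    T.card ≤ Module.finrank K E := by
  classical
  let Φ : (T → K) →ₗ[K] Module.Dual K E :=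
    LinearMap.mk₂ K (fun c g => ∑ i : T, c i * (g : κ → K) i)
      (fun g g' h => by rw [← Finset.sum_add_distrib]; simp [add_mul])
      (fun t g h => by simp only [smul_eq_mul, Finset.mul_sum, Pi.smul_apply, mul_assoc])
      (fun g h h' => by rw [← Finset.sum_add_distrib]; simp [mul_add])
      (fun t g h => by simp only [smul_eq_mul, Finset.mul_sum, Pi.smul_apply, Submodule.coe_smul]
                       exact Finset.sum_congr rfl fun i _ => by ring)
  have hΦ : Function.Injective Φ := by
    refine (injective_iff_map_eq_zero Φ).2 fun c hc => ?_
    ext i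
    have := h (fun j => if hj : j ∈ T then c ⟨j, hj⟩ else 0) (fun g hg => by
      have := LinearMap.congr_fun hc ⟨g, hg⟩
      simp only [Φ, LinearMap.mk₂_apply, LinearMap.zero_apply] at this
      rw [← this, ← Finset.sum_coe_sort T]
      exact Finset.sum_congr rfl fun j _ => by simp) i i.2
    simpa using this
  have := LinearMap.finrank_le_finrank_of_injective hΦ
  rwa [Subspace.dual_finrank_eq, Module.finrank_fintype_fun_eq_card, Fintype.card_coe] at this

end HilbertFunction

section PlaneCurves

variable {K V ι : Type*} [Field K] [AddCommGroup V] [Module K V]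

theorem finrank_polyFun_one_add_le {κ : Type*} [Finite κ] (X Y : κ → K) {m : ℕ}
    (h : Module.finrank K (leadingForms X Y (m + 1)) ≤ m) :
    Module.finrank K (polyFun X Y 1) + 3 * m ≤ Module.finrank K (polyFun X Y (m + 1)) := by
  induction m with
  | zero => simp
  | succ m ih =>
    have h1 : Module.finrank K (leadingForms X Y (m + 1)) ≤ m := by
      by_contra hcon
      have := finrank_leadingForms_lt X Y (k := m + 1) (by omega)
      omega
    have h2 := finrank_polyFun_succ X Y (m + 1)
    have := ih h1
    omega

theorem exists_plane_coordinates [Infinite K] [FiniteDimensional K V] {x : ι → V}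
    {Γ : Finset ι} {W : Submodule K V} (hx : ∀ i, x i ≠ 0) (hW : Module.finrank K W = 3)
    (hΓ : ∀ i ∈ Γ, x i ∈ W) (hne : Γ.Nonempty) :
    ∃ (e : Fin 3 → V) (l : Fin 3 → Module.Dual K V), (∀ i, e i ∈ W) ∧
      (∀ i j, l i (e j) = if i = j then 1 else 0) ∧ (∀ w ∈ W, w = ∑ i, l i w • e i) ∧
      ∀ i ∈ Γ, l 2 (x i) ≠ 0 := by
  obtain ⟨z, -, hz⟩ := exists_dual_vanishing_ne_zero x Γ (⊥ : Submodule K V)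
  obtain ⟨i0, hi0⟩ := hne
  have hz0 := hz i0 hi0 (by simpa using hx i0)
  have h1 := finrank_map_add_finrank_inf_ker z W
  have h2 : Module.finrank K (W.map z) ≤ 1 := by
    simpa using Submodule.finrank_le (W.map z)
  set N : Submodule K V := W ⊓ LinearMap.ker z with hN
  have : Nontrivial N := Module.nontrivial_of_finrank_pos (R := K) (by omega)
  obtain ⟨u, hu⟩ := exists_ne (0 : N)
  obtain ⟨v, huv⟩ := exists_linearIndependent_pair_of_one_lt_finrank (R := K) (M := N)
    (by omega) hu
  let e3 : W := ⟨(z (x i0))⁻¹ • x i0, W.smul_mem _ (hΓ i0 hi0)⟩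
  have he3 : z e3 = 1 := by simp [e3, hz0]
  let b0 : Fin 3 → W := ![⟨u, u.2.1⟩, ⟨v, v.2.1⟩, e3]
  have hu0 : z u = 0 := u.2.2
  have hv0 : z v = 0 := v.2.2
  have hli : LinearIndependent K b0 := by
    rw [Fintype.linearIndependent_iff]
    intro g hg
    have hg' : g 0 • (u : V) + g 1 • (v : V) + g 2 • (e3 : V) = 0 := by
      have := congrArg (Submodule.subtype W) hg
      simpa [Fin.sum_univ_three, b0] using this
    have hg2 : g 2 = 0 := by
      have := congrArg z hg'
      simpa [hu0, hv0, he3] using this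
    rw [hg2, zero_smul, add_zero] at hg'
    have h3 := LinearIndependent.pair_iff.1 huv (g 0) (g 1) (Subtype.ext (by simpa using hg'))
    intro i
    fin_cases i
    · exact h3.1
    · exact h3.2
    · exact hg2
  let b := basisOfLinearIndependentOfCardEqFinrank hli (by simp [hW])
  have hb : ∀ i, b i = b0 i := fun i => by simp [b]
  choose l hl using fun i => LinearMap.exists_extend (b.coord i)
  have hl' : ∀ i (w : W), l i w = b.repr w i := fun i w => by
    have := LinearMap.congr_fun (hl i) w
    simpa using this
  have hl2 : ∀ w : W, l 2 w = z w := by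
    have : b.coord 2 = z ∘ₗ W.subtype := by
      refine b.ext fun i => ?_
      rw [b.coord_apply, b.repr_self, LinearMap.comp_apply, hb]
      fin_cases i
      · simp [b0, hu0]
      · simp [b0, hv0]
      · simp [b0, he3]
    intro w
    have := LinearMap.congr_fun this w
    rw [hl']
    simpa using this
  refine ⟨fun i => b i, l, fun i => (b i).2, fun i j => ?_, fun w hw => ?_, fun i hi => ?_⟩
  · rw [hl', b.repr_self, Finsupp.single_apply]
    simp only [eq_comm]
  · have := congrArg (Submodule.subtype W) (b.sum_repr ⟨w, hw⟩)
    simp only [map_sum, map_smul, Submodule.subtype_apply] at this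
    rw [← this]
    refine Finset.sum_congr rfl fun i _ => ?_
    rw [this, ← hl' i ⟨w, hw⟩]
  · have := hl2 ⟨x i, hΓ i hi⟩
    rw [this]
    exact hz i hi (by simpa using hx i)

/-- Evaluating a function of the affine coordinates against a Cayley–Bacharach relation. -/
theorem sum_mul_polyFun_eq_zero {x : ι → V} {Γ : Finset ι} {d : ℕ} {c : ι → K}
    (hrel : ∀ L : List (Module.Dual K V), L.length = d →
      ∑ i ∈ Γ, c i * (L.map fun l => l (x i)).prod = 0) {l₁ l₂ z : Module.Dual K V}
    (hz : ∀ i ∈ Γ, z (x i) ≠ 0) {g : Γ → K}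
    (hg : g ∈ polyFun (fun i : Γ => l₁ (x i) / z (x i)) (fun i : Γ => l₂ (x i) / z (x i)) d) :
    ∑ i : Γ, c i * z (x i) ^ d * g i = 0 := by
  induction hg using Submodule.span_induction with
  | mem g hg =>
    obtain ⟨a, b, hab, rfl⟩ := hg
    rw [← hrel (List.replicate a l₁ ++ List.replicate b l₂ ++ List.replicate (d - a - b) z)
      (by simp; omega), ← Finset.sum_coe_sort Γ]
    refine Finset.sum_congr rfl fun i _ => ?_
    have := hz i i.2
    obtain ⟨e, rfl⟩ := Nat.exists_eq_add_of_le hab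
    have he : a + b + e - a - b = e := by omega
    simp only [List.map_append, List.map_replicate, List.prod_append, List.prod_replicate, he,
      Pi.mul_apply, Pi.pow_apply]
    rw [div_pow, div_pow]
    field_simp
    ring
  | zero => simp
  | add g g' _ _ ih ih' =>
    simp only [Pi.add_apply, mul_add, Finset.sum_add_distrib, ih, ih', add_zero]
  | smul t g _ ih =>
    rw [← smul_zero t, ← ih, Finset.smul_sum]
    refine Finset.sum_congr rfl fun i _ => ?_
    simp only [Pi.smul_apply, smul_eq_mul]
    ring

open Classical in
/-- A relation on the functions of degree `k` gives a Cayley–Bacharach set. -/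
theorem CayleyBacharach.of_polyFun {x : ι → V} {Γ : Finset ι} {k : ℕ}
    {l₁ l₂ z : Module.Dual K V} (hz : ∀ i ∈ Γ, z (x i) ≠ 0)
    (hl : ∀ l : Module.Dual K V, ∃ p q s : K,
      ∀ i ∈ Γ, l (x i) = p * l₁ (x i) + q * l₂ (x i) + s * z (x i))
    {T : Finset Γ} {c : Γ → K}
    (h : ∀ g ∈ polyFun (fun i : Γ => l₁ (x i) / z (x i)) (fun i : Γ => l₂ (x i) / z (x i)) k,
      ∑ i ∈ T, c i * g i = 0) :
    CayleyBacharach K x k ((T.filter fun i => c i ≠ 0).map (Function.Embedding.subtype _)) := by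
  set X : Γ → K := fun i => l₁ (x i) / z (x i) with hX
  set Y : Γ → K := fun i => l₂ (x i) / z (x i) with hY
  have key : ∀ L : List (Module.Dual K V), ∃ g ∈ polyFun X Y L.length,
      ∀ i : Γ, (L.map fun l => l (x i)).prod = g i * z (x i) ^ L.length := by
    intro L
    induction L with
    | nil => exact ⟨1, by simpa using monomial_mem_polyFun X Y (a := 0) (b := 0) le_rfl, by simp⟩
    | cons l L ih =>
      obtain ⟨g, hg, hgL⟩ := ih
      obtain ⟨p, q, s, hpqs⟩ := hl l
      refine ⟨g * (p • X + q • Y + s • 1), ?_, fun i => ?_⟩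
      · refine mul_mem_polyFun X Y hg (Submodule.add_mem _ (Submodule.add_mem _ ?_ ?_) ?_)
        · exact Submodule.smul_mem _ _
            (by simpa using monomial_mem_polyFun X Y (a := 1) (b := 0) (k := 1) le_rfl)
        · exact Submodule.smul_mem _ _
            (by simpa using monomial_mem_polyFun X Y (a := 0) (b := 1) (k := 1) le_rfl)
        · exact Submodule.smul_mem _ _
            (by simpa using monomial_mem_polyFun X Y (a := 0) (b := 0) (k := 1) (by omega))
      · have := hz i i.2
        rw [List.map_cons, List.prod_cons, hgL, hpqs i i.2, List.length_cons, pow_succ]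
        simp only [Pi.mul_apply, Pi.add_apply, Pi.smul_apply, smul_eq_mul, Pi.one_apply, hX, hY]
        field_simp
  refine ⟨fun i => if hi : i ∈ Γ then c ⟨i, hi⟩ / z (x i) ^ k else 0, fun i hi => ?_,
    fun L hL => ?_⟩
  · rw [Finset.mem_map] at hi
    obtain ⟨j, hj, rfl⟩ := hi
    have := (Finset.mem_filter.1 hj).2
    have := hz j j.2
    simp_all
  · obtain ⟨g, hg, hgL⟩ := key L
    rw [hL] at hg hgL
    refine Eq.trans ?_ (h g hg)
    rw [Finset.sum_map, Finset.sum_filter]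
    refine Finset.sum_congr rfl fun i _ => ?_
    have := hz i i.2
    by_cases h0 : c i = 0
    · simp [h0]
    · rw [if_pos h0, Function.Embedding.subtype_apply, hgL]
      beta_reduce
      rw [dif_pos i.2]
      field_simp

end PlaneCurves

section PlaneConics

variable {K V ι : Type*} [Field K] [AddCommGroup V] [Module K V]

open Classical in
theorem CayleyBacharach.two_mul_add_two_le_card [Infinite K] {x : ι → V}
    (hx : ∀ i, x i ≠ 0) (hinj : ∀ i j, x j ∈ Submodule.span K {x i} → j = i) {d : ℕ}
    {Γ : Finset ι} (h : CayleyBacharach K x d Γ) (hne : Γ.Nonempty)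
    (hGP : ∀ U : Submodule K V, Module.finrank K U ≤ 2 →
      (Γ.filter fun i => x i ∈ U).card ≤ 2) : 2 * d + 2 ≤ Γ.card := by
  by_contra hlt
  obtain ⟨W, hW, hΓ⟩ := h.subset_line hx hinj (by omega)
  have h1 := hGP W hW
  rw [Finset.filter_true_of_mem hΓ] at h1
  have := h.add_two_le_card hx hinj hne
  omega

open Classical in
/-- A Cayley–Bacharach set of at most `3 * d - 1` points of a plane, no three of them on a line,
lies on a conic. -/
theorem CayleyBacharach.exists_conic [Infinite K] [FiniteDimensional K V] {x : ι → V}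
    (hx : ∀ i, x i ≠ 0) (hinj : ∀ i j, x j ∈ Submodule.span K {x i} → j = i)
    {W : Submodule K V} (hW : Module.finrank K W ≤ 3) {d : ℕ} {Γ : Finset ι}
    (h : CayleyBacharach K x d Γ) (hne : Γ.Nonempty) (hcard : Γ.card + 1 ≤ 3 * d)
    (hΓ : ∀ i ∈ Γ, x i ∈ W)
    (hGP : ∀ U : Submodule K V, Module.finrank K U ≤ 2 →
      (Γ.filter fun i => x i ∈ U).card ≤ 2) :
    ∃ B : LinearMap.BilinForm K V, (∀ i ∈ Γ, B (x i) (x i) = 0) ∧ ∃ w ∈ W, B w w ≠ 0 := by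
  induction d using Nat.strong_induction_on generalizing Γ with
  | _ d ih =>
  by_contra hno
  push Not at hno
  have hn := h.two_mul_add_two_le_card hx hinj hne hGP
  have hW3 : Module.finrank K W = 3 := by
    by_contra hW3
    have := hGP W (by omega)
    rw [Finset.filter_true_of_mem hΓ] at this
    omega
  obtain ⟨e, l, heW, hle, hrepr, hz⟩ := exists_plane_coordinates hx hW3 hΓ hne
  set X : Γ → K := fun i => l 0 (x i) / l 2 (x i) with hX
  set Y : Γ → K := fun i => l 1 (x i) / l 2 (x i) with hY
  have hGPsub : ∀ Γ' ⊆ Γ, ∀ U : Submodule K V, Module.finrank K U ≤ 2 →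
      (Γ'.filter fun i => x i ∈ U).card ≤ 2 := fun Γ' hΓ' U hU =>
    (Finset.card_le_card (Finset.filter_subset_filter _ hΓ')).trans (hGP U hU)
  have H1 : 3 ≤ Module.finrank K (polyFun X Y 1) := by
    have hli : LinearIndependent K ![(1 : Γ → K), X, Y] := by
      rw [Fintype.linearIndependent_iff]
      intro g hg
      let φ : Module.Dual K V := g 0 • l 2 + g 1 • l 0 + g 2 • l 1
      have hφ : ∀ i ∈ Γ, φ (x i) = 0 := by
        intro i hi
        have h1 := congrFun hg ⟨i, hi⟩
        have h2 := hz i hi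
        simp only [Fin.sum_univ_three, Matrix.cons_val_zero, Matrix.cons_val_one,
          Matrix.cons_val, Pi.add_apply, Pi.smul_apply, smul_eq_mul, Pi.one_apply, Pi.zero_apply,
          hX, hY] at h1
        simp only [φ, LinearMap.add_apply, LinearMap.smul_apply, smul_eq_mul]
        field_simp at h1
        linear_combination h1
      have hWφ : W ≤ LinearMap.ker φ := by
        by_contra hcon
        have h1 : Module.finrank K (W ⊓ LinearMap.ker φ : Submodule K V) < Module.finrank K W :=
          Submodule.finrank_lt_finrank_of_lt (lt_of_le_of_ne inf_le_left fun h => hcon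
            (inf_eq_left.1 h))
        have h2 := hGP (W ⊓ LinearMap.ker φ) (by omega)
        rw [Finset.filter_true_of_mem fun i hi => ⟨hΓ i hi, hφ i hi⟩] at h2
        omega
      have h0 : ∀ j, φ (e j) = 0 := fun j => hWφ (heW j)
      have a0 := h0 0
      have a1 := h0 1
      have a2 := h0 2
      simp [φ, hle] at a0 a1 a2
      intro i
      fin_cases i
      · exact a2
      · exact a0
      · exact a1
    have h1 := finrank_span_eq_card hli
    rw [Fintype.card_fin] at h1
    refine (le_of_eq h1.symm).trans (Submodule.finrank_mono (Submodule.span_le.2 ?_))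
    rintro _ ⟨i, rfl⟩
    fin_cases i
    · simpa using monomial_mem_polyFun X Y (a := 0) (b := 0) (k := 1) (by omega)
    · simpa using monomial_mem_polyFun X Y (a := 1) (b := 0) (k := 1) (by omega)
    · simpa using monomial_mem_polyFun X Y (a := 0) (b := 1) (k := 1) (by omega)
  have H2 : 6 ≤ Module.finrank K (polyFun X Y 2) := by
    have hli : LinearIndependent K ![(1 : Γ → K), X, Y, X ^ 2, X * Y, Y ^ 2] := by
      rw [Fintype.linearIndependent_iff]
      intro g hg
      let B : LinearMap.BilinForm K V :=
        g 0 • LinearMap.BilinForm.linMulLin (l 2) (l 2) +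
        g 1 • LinearMap.BilinForm.linMulLin (l 0) (l 2) +
        g 2 • LinearMap.BilinForm.linMulLin (l 1) (l 2) +
        g 3 • LinearMap.BilinForm.linMulLin (l 0) (l 0) +
        g 4 • LinearMap.BilinForm.linMulLin (l 0) (l 1) +
        g 5 • LinearMap.BilinForm.linMulLin (l 1) (l 1)
      have hBapply : ∀ v, B v v = g 0 * (l 2 v * l 2 v) + g 1 * (l 0 v * l 2 v) +
          g 2 * (l 1 v * l 2 v) + g 3 * (l 0 v * l 0 v) + g 4 * (l 0 v * l 1 v) +
          g 5 * (l 1 v * l 1 v) := fun v => by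
        simp [B]
      have hB : ∀ i ∈ Γ, B (x i) (x i) = 0 := by
        intro i hi
        have h1 := congrFun hg ⟨i, hi⟩
        have h2 := hz i hi
        simp only [Fin.sum_univ_six, Matrix.cons_val_zero, Matrix.cons_val_one,
          Matrix.cons_val, Pi.add_apply, Pi.smul_apply, smul_eq_mul, Pi.one_apply, Pi.zero_apply,
          Pi.mul_apply, Pi.pow_apply, hX, hY] at h1
        rw [hBapply]
        field_simp at h1
        linear_combination h1
      have h0 := hno B hB
      have a0 := h0 _ (heW 0)
      have a1 := h0 _ (heW 1)
      have a2 := h0 _ (heW 2)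
      have a01 := h0 _ (W.add_mem (heW 0) (heW 1))
      have a02 := h0 _ (W.add_mem (heW 0) (heW 2))
      have a12 := h0 _ (W.add_mem (heW 1) (heW 2))
      rw [hBapply] at a0 a1 a2 a01 a02 a12
      simp [hle] at a0 a1 a2 a01 a02 a12
      simp only [a0, a1, a2, zero_add, add_zero] at a01 a02 a12
      intro i
      fin_cases i
      · exact a2
      · exact a02
      · exact a12
      · exact a0
      · exact a01
      · exact a1
    have h1 := finrank_span_eq_card hli
    rw [Fintype.card_fin] at h1
    refine (le_of_eq h1.symm).trans (Submodule.finrank_mono (Submodule.span_le.2 ?_))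
    rintro _ ⟨i, rfl⟩
    fin_cases i
    · simpa using monomial_mem_polyFun X Y (a := 0) (b := 0) (k := 2) (by omega)
    · simpa using monomial_mem_polyFun X Y (a := 1) (b := 0) (k := 2) (by omega)
    · simpa using monomial_mem_polyFun X Y (a := 0) (b := 1) (k := 2) (by omega)
    · simpa using monomial_mem_polyFun X Y (a := 2) (b := 0) (k := 2) (by omega)
    · simpa using monomial_mem_polyFun X Y (a := 1) (b := 1) (k := 2) (by omega)
    · simpa using monomial_mem_polyFun X Y (a := 0) (b := 2) (k := 2) (by omega)
  have hdual : ∀ j k, j + k = d →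
      Module.finrank K (polyFun X Y j) + Module.finrank K (polyFun X Y k) ≤ Γ.card := by
    rintro j k rfl
    obtain ⟨c, hc, hrel⟩ := h
    rw [← Fintype.card_coe Γ]
    refine finrank_add_finrank_le_of_pairing (c := fun i : Γ => c i * l 2 (x i) ^ (j + k))
      (fun i => mul_ne_zero (hc i i.2) (pow_ne_zero _ (hz i i.2))) fun g hg g' hg' => ?_
    exact sum_mul_polyFun_eq_zero hrel hz (mul_mem_polyFun X Y hg hg')
  have hd4 : 4 ≤ d := by
    by_contra hd4
    obtain rfl : d = 3 := by omega
    have := hdual 1 2 rfl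
    omega
  have h5 : ∀ B : LinearMap.BilinForm K V, (∃ i ∈ Γ, B (x i) (x i) ≠ 0) →
      (Γ.filter fun i => B (x i) (x i) = 0).card ≤ 5 := by
    rintro B ⟨i0, hi0, hB0⟩
    by_contra h6
    obtain ⟨d', rfl⟩ : ∃ d', d = d' + 2 := ⟨d - 2, by omega⟩
    have hsplit := Finset.card_filter_add_card_filter_not (s := Γ)
      (fun i => B (x i) (x i) = 0)
    have hCB := h.mul_bilin B
    set Γ' := Γ.filter fun i => B (x i) (x i) ≠ 0 with hΓ'
    change _ + Γ'.card = _ at hsplit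
    have hsub : Γ' ⊆ Γ := Finset.filter_subset _ _
    have hne' : Γ'.Nonempty := ⟨i0, Finset.mem_filter.2 ⟨hi0, hB0⟩⟩
    obtain ⟨B', hB', hw⟩ := ih d' (by omega) hCB hne' (by omega) (fun i hi => hΓ i (hsub hi))
      (hGPsub _ hsub)
    have h7 := hCB.two_mul_add_two_le_card hx hinj hne' (hGPsub _ hsub)
    obtain ⟨w, hwW, hw0⟩ := hw
    have hne'' : (Γ.filter fun i => B' (x i) (x i) ≠ 0).Nonempty := by
      by_contra hcon
      rw [Finset.not_nonempty_iff_eq_empty, Finset.filter_eq_empty_iff] at hcon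
      exact hw0 (hno B' (fun i hi => not_not.1 (hcon hi)) w hwW)
    have h8 := (h.mul_bilin B').two_mul_add_two_le_card hx hinj hne''
      (hGPsub _ (Finset.filter_subset _ _))
    have h9 : Γ'.card ≤ (Γ.filter fun i => B' (x i) (x i) = 0).card :=
      Finset.card_le_card fun i hi => Finset.mem_filter.2 ⟨hsub hi, hB' i hi⟩
    have h10 := Finset.card_filter_add_card_filter_not (s := Γ)
      (fun i => B' (x i) (x i) = 0)
    change _ + (Γ.filter fun i => B' (x i) (x i) ≠ 0).card = _ at h10
    omega
  have hHilb : ∀ j, 2 ≤ j → j < d → 3 * j - 1 ≤ Γ.card →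
      3 * j - 1 ≤ Module.finrank K (polyFun X Y j) := by
    intro j hj hjd hjn
    obtain ⟨T, -, hT⟩ := Finset.exists_subset_card_eq (s := (Finset.univ : Finset Γ))
      (n := 3 * j - 1) (by simpa using hjn)
    rw [← hT]
    refine card_le_finrank_of_forall_pairing fun c hc => ?_
    by_contra! hcon
    obtain ⟨i0, hi0, hc0⟩ := hcon
    have hCB := CayleyBacharach.of_polyFun hz (fun l' => ⟨l' (e 0), l' (e 1), l' (e 2),
      fun i hi => by
        conv_lhs => rw [hrepr _ (hΓ i hi)]
        simp only [Fin.sum_univ_three, map_add, map_smul, smul_eq_mul]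
        ring⟩) hc
    set T' := (T.filter fun i => c i ≠ 0).map (Function.Embedding.subtype (· ∈ Γ)) with hT'
    have hsub : T' ⊆ Γ := by
      intro i hi
      obtain ⟨k, -, rfl⟩ := Finset.mem_map.1 hi
      exact k.2
    have hTcard : T'.card ≤ T.card := by
      rw [hT', Finset.card_map]
      exact Finset.card_filter_le _ _
    have hne' : T'.Nonempty :=
      ⟨i0, Finset.mem_map.2 ⟨i0, Finset.mem_filter.2 ⟨hi0, hc0⟩, rfl⟩⟩
    obtain ⟨B, hB, w, hwW, hw⟩ := ih j hjd hCB hne' (by omega) (fun i hi => hΓ i (hsub hi))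
      (hGPsub _ hsub)
    have h6 := hCB.two_mul_add_two_le_card hx hinj hne' (hGPsub _ hsub)
    have h7 := h5 B (by
      by_contra! hcon
      exact hw (hno B hcon w hwW))
    have h8 : T'.card ≤ (Γ.filter fun i => B (x i) (x i) = 0).card :=
      Finset.card_le_card fun i hi => Finset.mem_filter.2 ⟨hsub hi, hB i hi⟩
    omega
  obtain ⟨m, rfl⟩ : ∃ m, d = m + 3 := ⟨d - 3, by omega⟩
  have g1 := hHilb ((m + 3) / 2) (by omega) (by omega) (by omega)
  have g2 := hHilb (m + 3 - (m + 3) / 2) (by omega) (by omega) (by omega)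
  have g3 := hdual ((m + 3) / 2) (m + 3 - (m + 3) / 2) (by omega)
  have g4 := hHilb (m + 1 + 1) (by omega) (by omega) (by omega)
  have g5 := hdual 1 (m + 1 + 1) (by omega)
  have g6 := hHilb (m + 1) (by omega) (by omega) (by omega)
  have g7 := hdual 2 (m + 1) (by omega)
  have g8 := finrank_polyFun_succ X Y (m + 1)
  have g9 := finrank_polyFun_one_add_le X Y (m := m) (by omega)
  omega

end PlaneConics

section Structure

variable {K V ι : Type*} [Field K] [AddCommGroup V] [Module K V]

theorem finrank_span_pair_eq_two {p q : V} (hpq : LinearIndependent K ![p, q]) :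
    Module.finrank K (Submodule.span K {p, q}) = 2 := by
  have h := finrank_span_eq_card hpq
  rwa [Matrix.range_cons_cons_empty, Fintype.card_fin] at h

theorem span_pair_eq_of_finrank_le_two [FiniteDimensional K V] {p q : V}
    (hpq : LinearIndependent K ![p, q]) {U : Submodule K V} (hU : Module.finrank K U ≤ 2)
    (hp : p ∈ U) (hq : q ∈ U) : Submodule.span K {p, q} = U :=
  Submodule.eq_of_le_of_finrank_le (Submodule.span_le.2 (by simp [Set.insert_subset_iff, hp, hq]))
    (by rw [finrank_span_pair_eq_two hpq]; exact hU)

theorem linearIndependent_pair_of_ne {x : ι → V}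
    (hx : ∀ i, x i ≠ 0) (hinj : ∀ i j, x j ∈ Submodule.span K {x i} → j = i) {i j : ι}
    (hij : i ≠ j) : LinearIndependent K ![x i, x j] := by
  rw [LinearIndependent.pair_iff' (hx i)]
  intro a ha
  exact hij (hinj i j (ha ▸ Submodule.smul_mem _ a (Submodule.mem_span_singleton_self _))).symm

theorem exists_line_of_conic_contains_line [FiniteDimensional K V] {W : Submodule K V}
    (hW : Module.finrank K W ≤ 3) {p q w : V} (hpq : LinearIndependent K ![p, q]) (hp : p ∈ W)
    (hq : q ∈ W) (hw : w ∈ W) {B : LinearMap.BilinForm K V} (hBp : B p p = 0) (hBq : B q q = 0)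
    (hBpq : B p q + B q p = 0) (hBw : B w w ≠ 0) :
    ∃ U : Submodule K V, Module.finrank K U ≤ 2 ∧
      ∀ v ∈ W, B v v = 0 → v ∈ Submodule.span K {p, q} ∨ v ∈ U := by
  have hwn : w ∉ Submodule.span K {p, q} := by
    intro h
    obtain ⟨a, b, rfl⟩ := Submodule.mem_span_pair.1 h
    apply hBw
    simp only [map_add, map_smul, LinearMap.add_apply, LinearMap.smul_apply, smul_eq_mul]
    linear_combination a ^ 2 * hBp + b ^ 2 * hBq + a * b * hBpq
  have hspan : Submodule.span K {p, q, w} = W := by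
    refine Submodule.eq_of_le_of_finrank_le
      (Submodule.span_le.2 (by simp [Set.insert_subset_iff, hp, hq, hw])) ?_
    have h1 : Submodule.span K {p, q} < Submodule.span K {p, q, w} := by
      refine lt_of_le_of_ne (Submodule.span_mono (by
        intro v hv
        simp only [Set.mem_insert_iff, Set.mem_singleton_iff] at hv ⊢
        tauto)) fun h => hwn ?_
      rw [h]
      exact Submodule.subset_span (by simp)
    have h2 := Submodule.finrank_lt_finrank_of_lt h1
    rw [finrank_span_pair_eq_two hpq] at h2
    omega
  set s := B p w + B w p with hs
  set t := B q w + B w q with ht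
  refine ⟨Submodule.span K {p - (s / B w w) • w, q - (t / B w w) • w}, finrank_span_pair_le _ _,
    fun v hv hB => ?_⟩
  rw [← hspan, Submodule.mem_span_triple] at hv
  obtain ⟨a, b, c, rfl⟩ := hv
  by_cases hc : c = 0
  · left
    rw [Submodule.mem_span_pair]
    exact ⟨a, b, by simp [hc]⟩
  · right
    rw [Submodule.mem_span_pair]
    refine ⟨a, b, ?_⟩
    have h1 : c * (a * s + b * t + c * B w w) = 0 := by
      rw [← hB]
      simp only [map_add, map_smul, LinearMap.add_apply, LinearMap.smul_apply, smul_eq_mul, hs, ht]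
      linear_combination - a ^ 2 * hBp - b ^ 2 * hBq - a * b * hBpq
    have h2 := (mul_eq_zero.1 h1).resolve_left hc
    have h3 : c = -(a * (s / B w w) + b * (t / B w w)) := by
      field_simp
      linear_combination h2
    rw [h3]
    module

open Classical in
/-- The structure of Cayley–Bacharach sets of at most `3 * d - 1` points. -/
theorem CayleyBacharach.two_lines_or_conic [Infinite K] [FiniteDimensional K V] {x : ι → V}
    (hx : ∀ i, x i ≠ 0) (hinj : ∀ i j, x j ∈ Submodule.span K {x i} → j = i) {d : ℕ}
    {Γ : Finset ι} (h : CayleyBacharach K x d Γ) (hcard : Γ.card + 1 ≤ 3 * d) :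
    (∃ W₁ W₂ : Submodule K V, Module.finrank K W₁ ≤ 2 ∧ Module.finrank K W₂ ≤ 2 ∧
      ∀ i ∈ Γ, x i ∈ W₁ ∨ x i ∈ W₂) ∨
    ∃ W : Submodule K V, Module.finrank K W ≤ 3 ∧ (∀ i ∈ Γ, x i ∈ W) ∧
      (∀ U : Submodule K V, Module.finrank K U ≤ 2 → (Γ.filter fun i => x i ∈ U).card ≤ 2) ∧
      ∃ B : LinearMap.BilinForm K V, (∀ i ∈ Γ, B (x i) (x i) = 0) ∧ ∃ w ∈ W, B w w ≠ 0 := by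
  induction d generalizing Γ with
  | zero => omega
  | succ d ih =>
  rw [or_iff_not_imp_left]
  intro hno
  have hline : ∀ U : Submodule K V, Module.finrank K U ≤ 2 →
      (Γ.filter fun i => x i ∈ U).card ≤ d := by
    intro U hU
    by_contra hlt
    have h1 := card_filter_mem_add_card_filter_notMem x Γ U
    obtain ⟨W, hW, hsub⟩ := (h.diff U).subset_line hx hinj (by omega)
    refine hno ⟨U, W, hU, hW, fun i hi => ?_⟩
    by_cases hiU : x i ∈ U
    · exact Or.inl hiU
    · exact Or.inr (hsub i (Finset.mem_filter.2 ⟨hi, hiU⟩))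
  have hne : Γ.Nonempty := by
    by_contra hemp
    rw [Finset.not_nonempty_iff_eq_empty] at hemp
    exact hno ⟨⊥, ⊥, by simp, by simp, by simp [hemp]⟩
  have hn := h.add_two_le_card hx hinj hne
  by_cases hU : ∃ U : Submodule K V, 3 ≤ (Γ.filter fun i => x i ∈ U).card ∧ ∃ i ∈ Γ, x i ∉ U
  · obtain ⟨U, hU3, i0, hi0, hi0U⟩ := hU
    have h1 := card_filter_mem_add_card_filter_notMem x Γ U
    have hCB := h.diff U
    set Γ' := Γ.filter fun i => x i ∉ U with hΓ'
    have hsub : Γ' ⊆ Γ := Finset.filter_subset _ _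
    have hne' : Γ'.Nonempty := ⟨i0, Finset.mem_filter.2 ⟨hi0, hi0U⟩⟩
    obtain ⟨d, rfl⟩ : ∃ d', d = d' + 1 := ⟨d - 1, by omega⟩
    rcases ih hCB (by omega) with ⟨W₁, W₂, hW₁, hW₂, hW⟩ | ⟨W, hW, hΓW, hGP, B, hB, w, hw, hBw⟩
    · exfalso
      rcases (Γ'.filter fun i => x i ∉ W₂).eq_empty_or_nonempty with h0 | h0
      · have h2 : Γ'.card ≤ (Γ.filter fun i => x i ∈ W₂).card :=
          Finset.card_le_card fun i hi => Finset.mem_filter.2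
            ⟨hsub hi, not_not.1 (Finset.filter_eq_empty_iff.1 h0 hi)⟩
        have h3 := hCB.add_two_le_card hx hinj hne'
        have h4 := hline W₂ hW₂
        omega
      · have h2 : (Γ'.filter fun i => x i ∉ W₂).card ≤ (Γ.filter fun i => x i ∈ W₁).card :=
          Finset.card_le_card fun i hi => by
            rw [Finset.mem_filter] at hi ⊢
            exact ⟨hsub hi.1, (hW i hi.1).resolve_right hi.2⟩
        have h3 := (hCB.diff W₂).add_two_le_card hx hinj h0
        have h4 := hline W₁ hW₁
        omega
    · have h2 := hCB.two_mul_add_two_le_card hx hinj hne' hGP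
      have hΓW' : ∀ i ∈ Γ, x i ∈ W := by
        by_contra! hcon
        obtain ⟨i, hi, hiW⟩ := hcon
        have h3 := (h.diff W).add_two_le_card hx hinj ⟨i, Finset.mem_filter.2 ⟨hi, hiW⟩⟩
        have h4 := card_filter_mem_add_card_filter_notMem x Γ W
        have h5 : Γ'.card ≤ (Γ.filter fun i => x i ∈ W).card :=
          Finset.card_le_card fun i hi => Finset.mem_filter.2 ⟨hsub hi, hΓW i hi⟩
        omega
      have hΓB : ∀ i ∈ Γ, B (x i) (x i) = 0 := by
        by_contra! hcon
        obtain ⟨i, hi, hiW⟩ := hcon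
        have h3 := (h.mul_bilin B).add_two_le_card hx hinj ⟨i, Finset.mem_filter.2 ⟨hi, hiW⟩⟩
        have h4 := Finset.card_filter_add_card_filter_not (s := Γ) (fun i => B (x i) (x i) = 0)
        change _ + (Γ.filter fun i => B (x i) (x i) ≠ 0).card = _ at h4
        have h5 : Γ'.card ≤ (Γ.filter fun i => B (x i) (x i) = 0).card :=
          Finset.card_le_card fun i hi => Finset.mem_filter.2 ⟨hsub hi, hB i hi⟩
        omega
      refine ⟨W, hW, hΓW', ?_, B, hΓB, w, hw, hBw⟩
      by_contra! hcon
      obtain ⟨U₀, hU₀, hcon⟩ := hcon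
      obtain ⟨i, j, k, hi, hj, hk, hij, hik, hjk⟩ := Finset.two_lt_card_iff.1 hcon
      rw [Finset.mem_filter] at hi hj hk
      have hli := linearIndependent_pair_of_ne hx hinj hij
      have hsp := span_pair_eq_of_finrank_le_two hli hU₀ hi.2 hj.2
      obtain ⟨a, b, hab⟩ := Submodule.mem_span_pair.1 (hsp ▸ hk.2)
      have ha : a ≠ 0 := by
        rintro rfl
        refine hjk (hinj j k ?_).symm
        rw [← hab, zero_smul, zero_add]
        exact Submodule.smul_mem _ b (Submodule.mem_span_singleton_self _)
      have hb : b ≠ 0 := by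
        rintro rfl
        refine hik (hinj i k ?_).symm
        rw [← hab, zero_smul, add_zero]
        exact Submodule.smul_mem _ a (Submodule.mem_span_singleton_self _)
      have hBi := hΓB i hi.1
      have hBj := hΓB j hj.1
      have hBk := hΓB k hk.1
      rw [← hab] at hBk
      simp only [map_add, map_smul, LinearMap.add_apply, LinearMap.smul_apply, smul_eq_mul] at hBk
      have hBij : B (x i) (x j) + B (x j) (x i) = 0 := by
        have : a * b * (B (x i) (x j) + B (x j) (x i)) = 0 := by
          linear_combination hBk - a ^ 2 * hBi - b ^ 2 * hBj
        exact (mul_eq_zero.1 this).resolve_left (mul_ne_zero ha hb)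
      obtain ⟨U₁, hU₁, hUv⟩ := exists_line_of_conic_contains_line hW hli (hΓW' i hi.1)
        (hΓW' j hj.1) hw hBi hBj hBij hBw
      exact hno ⟨_, U₁, finrank_span_pair_le _ _, hU₁,
        fun i hi => hUv _ (hΓW' i hi) (hΓB i hi)⟩
  · push Not at hU
    have hGP : ∀ U : Submodule K V, Module.finrank K U ≤ 2 →
        (Γ.filter fun i => x i ∈ U).card ≤ 2 := by
      intro U hU2
      by_contra hlt
      exact hno ⟨U, ⊥, hU2, by simp, fun i hi => Or.inl (hU U (by omega) i hi)⟩
    obtain ⟨i, j, k, hi, hj, hk, hij, hik, hjk⟩ := Finset.two_lt_card_iff.1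
      (show 2 < Γ.card by
        have := h.two_mul_add_two_le_card hx hinj hne hGP
        omega)
    have hΓW := hU (Submodule.span K {x i, x j, x k}) (by
      rw [← Finset.card_eq_three.2 ⟨i, j, k, hij, hik, hjk, rfl⟩]
      refine Finset.card_le_card fun m hm => ?_
      simp only [Finset.mem_insert, Finset.mem_singleton] at hm
      rw [Finset.mem_filter]
      rcases hm with rfl | rfl | rfl
      · exact ⟨hi, Submodule.subset_span (by simp)⟩
      · exact ⟨hj, Submodule.subset_span (by simp)⟩
      · exact ⟨hk, Submodule.subset_span (by simp)⟩)
    exact ⟨_, finrank_span_triple_le _ _ _, hΓW, hGP,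
      h.exists_conic hx hinj (finrank_span_triple_le _ _ _) hne hcard hΓW hGP⟩

end Structure

section LinearForms

variable {K : Type} [Field K] {r d : ℕ}

/-- The linear form with given coefficients. -/
noncomputable def linForm (K : Type) [Field K] (r : ℕ) :
    (Fin (r + 1) → K) →ₗ[K] MvPolynomial (Fin (r + 1)) K where
  toFun v := ∑ i, C (v i) * X i
  map_add' v w := by simp [add_mul, Finset.sum_add_distrib]
  map_smul' t v := by simp [Finset.smul_sum, smul_eq_C_mul, mul_assoc]

theorem powForm_eq (p : Projectivization K (Fin (r + 1) → K)) :
    powForm K r d p = linForm K r p.rep ^ d := rfl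

/-- Polarization: a product of functionals extends to a functional on powers of linear forms. -/
theorem exists_functional_linForm_pow [CharZero K]
    (L : List (Module.Dual K (Fin (r + 1) → K))) :
    ∃ Φ : MvPolynomial (Fin (r + 1)) K →ₗ[K] K, ∀ v : Fin (r + 1) → K,
      Φ (linForm K r v ^ L.length) = (L.map fun l => l v).prod := by
  induction L with
  | nil => exact ⟨lcoeff K 0, fun v => by simp⟩
  | cons l L ih =>
    obtain ⟨Φ, hΦ⟩ := ih
    let D : Derivation K (MvPolynomial (Fin (r + 1)) K) (MvPolynomial (Fin (r + 1)) K) :=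
      mkDerivation K fun j => C (l (Pi.single j 1))
    have hD : ∀ v, D (linForm K r v) = C (l v) := by
      intro v
      have : l v = ∑ j, v j * l (Pi.single j 1) := by
        conv_lhs => rw [LinearMap.pi_apply_eq_sum_univ l v]
        simp only [smul_eq_mul]
        exact Finset.sum_congr rfl fun j _ => by
          congr 2
          ext k
          simp [Pi.single_apply, eq_comm]
      rw [this]
      simp [linForm, D, mkDerivation_X, ← smul_eq_C_mul]
    have hn : ((L.length + 1 : ℕ) : K) ≠ 0 := Nat.cast_ne_zero.2 (Nat.succ_ne_zero _)
    refine ⟨((L.length + 1 : ℕ) : K)⁻¹ • Φ ∘ₗ (D : _ →ₗ[K] _), fun v => ?_⟩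
    have h1 : D (linForm K r v ^ (L.length + 1)) =
        (((L.length + 1 : ℕ) : K) * l v) • linForm K r v ^ L.length := by
      rw [Derivation.leibniz_pow, hD, Nat.add_sub_cancel, smul_eq_C_mul, nsmul_eq_mul, smul_eq_mul,
        map_mul, map_natCast]
      ring
    rw [List.length_cons, LinearMap.smul_apply, LinearMap.comp_apply, Derivation.coeFn_coe, h1,
      map_smul, hΦ, List.map_cons, List.prod_cons, smul_eq_mul, smul_eq_mul, mul_assoc,
      inv_mul_cancel_left₀ hn]

theorem sum_mul_prod_eq_zero_of_sum_linForm_pow [CharZero K] {ι : Type*} {s : Finset ι}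
    {v : ι → Fin (r + 1) → K} (L : List (Module.Dual K (Fin (r + 1) → K))) (c : ι → K)
    (h : ∑ i ∈ s, c i • linForm K r (v i) ^ L.length = 0) :
    ∑ i ∈ s, c i * (L.map fun l => l (v i)).prod = 0 := by
  obtain ⟨Φ, hΦ⟩ := exists_functional_linForm_pow L
  have := congrArg Φ h
  simpa [hΦ] using this

/-- The powers of the linear forms along a rational curve of degree `e`. -/
theorem exists_linForm_pow_expansion (e d : ℕ) (c : ℕ → Fin (r + 1) → K) :
    ∃ F : ℕ → MvPolynomial (Fin (r + 1)) K, F (e * d) = linForm K r (c e) ^ d ∧ ∀ y : K,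
      linForm K r (∑ k ∈ Finset.range (e + 1), y ^ k • c k) ^ d =
        ∑ k ∈ Finset.range (e * d + 1), y ^ k • F k := by
  let P : Polynomial (MvPolynomial (Fin (r + 1)) K) :=
    ∑ k ∈ Finset.range (e + 1), Polynomial.C (linForm K r (c k)) * Polynomial.X ^ k
  have hP : P.natDegree ≤ e := by
    refine Polynomial.natDegree_sum_le_of_forall_le _ _ fun k hk => ?_
    exact (Polynomial.natDegree_C_mul_X_pow_le _ _).trans
      (Nat.lt_succ_iff.1 (Finset.mem_range.1 hk))
  refine ⟨fun k => (P ^ d).coeff k, ?_, fun y => ?_⟩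
  · simp only [mul_comm e d, Polynomial.coeff_pow_of_natDegree_le hP]
    simp [P, Polynomial.finsetSum_coeff, Polynomial.coeff_C_mul, Polynomial.coeff_X_pow]
  have h1 : Polynomial.eval (C y) P = linForm K r (∑ k ∈ Finset.range (e + 1), y ^ k • c k) := by
    simp only [P, Polynomial.eval_finsetSum, Polynomial.eval_mul, Polynomial.eval_C,
      Polynomial.eval_pow, Polynomial.eval_X, map_sum, map_smul]
    refine Finset.sum_congr rfl fun k _ => ?_
    rw [smul_eq_C_mul, map_pow, mul_comm]
  rw [← h1, ← Polynomial.eval_pow, Polynomial.eval_eq_sum_range' (n := e * d + 1)]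
  · refine Finset.sum_congr rfl fun k _ => ?_
    rw [smul_eq_C_mul, map_pow, mul_comm]
  · have := Polynomial.natDegree_pow_le_of_le d hP
    rw [mul_comm e d]
    omega

theorem mem_decompSpan_iff {A : Finset (Projectivization K (Fin (r + 1) → K))}
    {f : MvPolynomial (Fin (r + 1)) K} :
    f ∈ decompSpan K r d ↑A ↔ ∃ a : Projectivization K (Fin (r + 1) → K) → K,
      ∑ p ∈ A, a p • powForm K r d p = f := by
  classical
  rw [decompSpan, Submodule.mem_span_image_finset_iff_exists_fun]
  constructor
  · rintro ⟨c, hc⟩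
    refine ⟨fun p => if hp : p ∈ A then c ⟨p, hp⟩ else 0, ?_⟩
    rw [← hc, ← Finset.sum_coe_sort A]
    exact Finset.sum_congr rfl fun p _ => by simp [p.2]
  · rintro ⟨a, ha⟩
    exact ⟨fun p => a p, by rw [← ha, ← Finset.sum_coe_sort A]⟩

theorem sum_smul_powForm_mem_decompSpan {A : Finset (Projectivization K (Fin (r + 1) → K))}
    (a : Projectivization K (Fin (r + 1) → K) → K) :
    ∑ p ∈ A, a p • powForm K r d p ∈ decompSpan K r d ↑A :=
  mem_decompSpan_iff.2 ⟨a, rfl⟩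

theorem symRank_le {A : Finset (Projectivization K (Fin (r + 1) → K))}
    {f : MvPolynomial (Fin (r + 1)) K} (h : f ∈ decompSpan K r d ↑A) :
    symRank K r d f ≤ A.card :=
  Nat.sInf_le ⟨A, rfl, h⟩

/-- Infinitely many replacements of a part of a decomposition give infinitely many
decompositions. -/
theorem decompSet_infinite_of_replace {f : MvPolynomial (Fin (r + 1)) K}
    {A A' : Finset (Projectivization K (Fin (r + 1) → K))} (hA : A ∈ decompSet K r d f)
    {a : Projectivization K (Fin (r + 1) → K) → K} (ha : ∑ p ∈ A, a p • powForm K r d p = f)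
    (hA' : A' ⊆ A)
    (hinf : {A'' : Finset (Projectivization K (Fin (r + 1) → K)) | A''.card ≤ A'.card ∧
      ∑ p ∈ A', a p • powForm K r d p ∈ decompSpan K r d ↑A''}.Infinite) :
    (decompSet K r d f).Infinite := by
  classical
  have hmem : ∀ A'' : Finset (Projectivization K (Fin (r + 1) → K)),
      ∑ p ∈ A', a p • powForm K r d p ∈ decompSpan K r d ↑A'' →
      f ∈ decompSpan K r d ↑(A \ A' ∪ A'') := by
    intro A'' h
    rw [← ha, ← Finset.sum_sdiff hA']
    refine Submodule.add_mem _ ?_ ?_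
    · exact Submodule.span_mono (Set.image_mono (by simp))
        (sum_smul_powForm_mem_decompSpan (A := A \ A') a)
    · exact Submodule.span_mono (Set.image_mono (by simp)) h
  have hcard : ∀ A'' : Finset (Projectivization K (Fin (r + 1) → K)), A''.card ≤ A'.card →
      ∑ p ∈ A', a p • powForm K r d p ∈ decompSpan K r d ↑A'' →
      (A \ A' ∪ A'').card = symRank K r d f ∧ Disjoint (A \ A') A'' := by
    intro A'' h1 h2
    have h3 := symRank_le (hmem A'' h2)
    have h4 := Finset.card_union_add_card_inter (A \ A') A''
    have h5 := Finset.card_sdiff_add_card_eq_card hA'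
    have h6 := hA.2
    refine ⟨by omega, ?_⟩
    rw [Finset.disjoint_iff_inter_eq_empty, ← Finset.card_eq_zero]
    omega
  refine Set.infinite_of_injOn_mapsTo (f := fun A'' => A \ A' ∪ A'') ?_ ?_ hinf
  · rintro A₁ ⟨h1, h1'⟩ A₂ ⟨h2, h2'⟩ h
    have e1 := Finset.union_sdiff_cancel_left (hcard A₁ h1 h1').2
    have e2 := Finset.union_sdiff_cancel_left (hcard A₂ h2 h2').2
    rw [← e1, ← e2]
    exact congrArg (· \ (A \ A')) h
  · rintro A'' ⟨h1, h1'⟩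
    exact ⟨by exact_mod_cast hmem A'' h1', (hcard A'' h1 h1').1⟩

theorem linForm_pow_mem_span_powForm {v : Fin (r + 1) → K} (hv : v ≠ 0)
    {S : Set (Projectivization K (Fin (r + 1) → K))} (hS : Projectivization.mk K v hv ∈ S) :
    linForm K r v ^ d ∈ decompSpan K r d S := by
  obtain ⟨t, ht⟩ := Projectivization.exists_smul_eq_mk_rep K v hv
  have h1 : linForm K r v ^ d = ((t⁻¹ : Kˣ) : K) ^ d • powForm K r d (Projectivization.mk K v hv) := by
    rw [powForm_eq, ← smul_pow, ← map_smul, ← ht, Units.smul_def, smul_smul, ← Units.val_mul,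
      inv_mul_cancel, Units.val_one, one_smul]
  rw [h1]
  exact Submodule.smul_mem _ _ (Submodule.subset_span (Set.mem_image_of_mem _ hS))

end LinearForms

section Curves

variable {K : Type} [Field K] {r d : ℕ}

theorem Projectivization.eq_of_rep_mem_span_rep {K V : Type*} [Field K] [AddCommGroup V]
    [Module K V] (p q : Projectivization K V) (h : q.rep ∈ Submodule.span K {p.rep}) : q = p := by
  obtain ⟨t, ht⟩ := Submodule.mem_span_singleton.1 h
  rw [← q.mk_rep, ← p.mk_rep, Projectivization.mk_eq_mk_iff']
  exact ⟨t, ht⟩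

/-- The data of a parametrized curve `φ` whose parameter is recovered by linear functionals. -/
structure IsAffineParam (φ : K → Fin (r + 1) → K) (l₀ l₁ : Module.Dual K (Fin (r + 1) → K)) :
    Prop where
  zero : ∀ y, l₀ (φ y) = 1
  one : ∀ y, l₁ (φ y) = y

namespace IsAffineParam

variable {φ : K → Fin (r + 1) → K} {l₀ l₁ : Module.Dual K (Fin (r + 1) → K)}

theorem ne_zero (h : IsAffineParam φ l₀ l₁) (y : K) : φ y ≠ 0 := by
  intro h0
  have := h.zero y
  simp [h0] at this

/-- The point of projective space with parameter `y`. -/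
noncomputable def point (h : IsAffineParam φ l₀ l₁) (y : K) :
    Projectivization K (Fin (r + 1) → K) :=
  Projectivization.mk K (φ y) (h.ne_zero y)

theorem point_injective (h : IsAffineParam φ l₀ l₁) : Function.Injective h.point := by
  intro y z hyz
  obtain ⟨t, ht⟩ := (Projectivization.mk_eq_mk_iff' K _ _ _ _).1 hyz
  have h0 := congrArg l₀ ht
  have h1 := congrArg l₁ ht
  rw [map_smul, h.zero, h.zero, smul_eq_mul, mul_one] at h0
  rw [map_smul, h.one, h.one, h0, smul_eq_mul, one_mul] at h1
  exact h1.symm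

theorem point_rep (h : IsAffineParam φ l₀ l₁) (y : K) :
    ∃ s : K, s ≠ 0 ∧ (h.point y).rep = s • φ y := by
  obtain ⟨t, ht⟩ := Projectivization.exists_smul_eq_mk_rep K (φ y) (h.ne_zero y)
  exact ⟨t, t.ne_zero, ht.symm⟩

theorem point_eq (h : IsAffineParam φ l₀ l₁) {p : Projectivization K (Fin (r + 1) → K)} {y s : K}
    (hp : p.rep = s • φ y) : h.point y = p := by
  rw [point, ← p.mk_rep, Projectivization.mk_eq_mk_iff']
  have hs : s ≠ 0 := by
    rintro rfl
    exact p.rep_nonzero (by simpa using hp)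
  exact ⟨s⁻¹, by rw [hp, smul_smul, inv_mul_cancel₀ hs, one_smul]⟩

open Classical in
theorem exists_image_point (h : IsAffineParam φ l₀ l₁)
    {D : Finset (Projectivization K (Fin (r + 1) → K))}
    (hD : ∀ p ∈ D, ∃ y s : K, p.rep = s • φ y) :
    ∃ Y : Finset K, Y.card = D.card ∧ Y.image h.point = D := by
  refine ⟨D.preimage h.point h.point_injective.injOn, ?_⟩
  have h1 : (D.preimage h.point h.point_injective.injOn).image h.point = D := by
    ext p
    simp only [Finset.mem_image, Finset.mem_preimage]
    constructor
    · rintro ⟨y, hy, rfl⟩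
      exact hy
    · intro hp
      obtain ⟨y, s, hys⟩ := hD p hp
      exact ⟨y, by rwa [h.point_eq hys], h.point_eq hys⟩
  refine ⟨?_, h1⟩
  rw [← h1, Finset.card_image_of_injective _ h.point_injective, h1]

theorem exists_rep_eq (h : IsAffineParam φ l₀ l₁) :
    ∃ s : K → K, ∀ y, s y ≠ 0 ∧ (h.point y).rep = s y • φ y := by
  choose s hs using h.point_rep
  exact ⟨s, hs⟩

open Classical in
theorem sum_linForm_pow_mem (h : IsAffineParam φ l₀ l₁) (Y : Finset K) (b : K → K) :
    ∑ y ∈ Y, b y • linForm K r (φ y) ^ d ∈ decompSpan K r d ↑(Y.image h.point) := by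
  refine Submodule.sum_mem _ fun y hy => Submodule.smul_mem _ _ ?_
  exact linForm_pow_mem_span_powForm (h.ne_zero y) (Finset.mem_image_of_mem h.point hy)

end IsAffineParam

/-- Equal moments give equal combinations of powers of linear forms along a rational curve. -/
theorem sum_linForm_pow_eq_of_moments {e d : ℕ} {c : ℕ → Fin (r + 1) → K}
    {Y Z : Finset K} {a b : K → K} {κ : K}
    (h : ∀ q : Polynomial K, q.natDegree ≤ e * d →
      ∑ y ∈ Y, a y * q.eval y = ∑ y ∈ Z, b y * q.eval y + κ * q.coeff (e * d)) :
    ∑ y ∈ Y, a y • linForm K r (∑ k ∈ Finset.range (e + 1), y ^ k • c k) ^ d =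
      ∑ y ∈ Z, b y • linForm K r (∑ k ∈ Finset.range (e + 1), y ^ k • c k) ^ d +
        κ • linForm K r (c e) ^ d := by
  obtain ⟨F, hF1, hF⟩ := exists_linForm_pow_expansion e d c
  have key : ∀ (Y : Finset K) (a : K → K),
      ∑ y ∈ Y, a y • linForm K r (∑ k ∈ Finset.range (e + 1), y ^ k • c k) ^ d =
        ∑ k ∈ Finset.range (e * d + 1), (∑ y ∈ Y, a y * y ^ k) • F k := by
    intro Y a
    simp_rw [hF, Finset.smul_sum, smul_smul, Finset.sum_smul]
    exact Finset.sum_comm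
  rw [key, key, ← hF1]
  have h2 : ∀ k ∈ Finset.range (e * d + 1), (∑ y ∈ Y, a y * y ^ k) • F k =
      (∑ y ∈ Z, b y * y ^ k) • F k + (if k = e * d then κ • F k else 0) := by
    intro k hk
    have := h (Polynomial.X ^ k) (by
      rw [Polynomial.natDegree_X_pow]
      exact Nat.lt_succ_iff.1 (Finset.mem_range.1 hk))
    simp only [Polynomial.eval_pow, Polynomial.eval_X, Polynomial.coeff_X_pow] at this
    rw [this, add_smul]
    congr 1
    by_cases hke : k = e * d
    · simp [hke]
    · simp [hke, Ne.symm hke]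
  rw [Finset.sum_congr rfl h2, Finset.sum_add_distrib]
  congr 1
  simp

/-- If half of the degree of a rational curve is reached by part of a decomposition, then there
are infinitely many decompositions. -/
theorem decompSet_infinite_of_param [IsAlgClosed K] {f : MvPolynomial (Fin (r + 1)) K} (e : ℕ)
    (c : ℕ → Fin (r + 1) → K) {l₀ l₁ : Module.Dual K (Fin (r + 1) → K)}
    (h : IsAffineParam (fun y => ∑ k ∈ Finset.range (e + 1), y ^ k • c k) l₀ l₁)
    {D D' : Finset (Projectivization K (Fin (r + 1) → K))} (hD : D ∈ decompSet K r d f)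
    (hD' : D' ⊆ D)
    (hcurve : ∀ p ∈ D', ∃ y s : K, p.rep = s • ∑ k ∈ Finset.range (e + 1), y ^ k • c k)
    (hcard : e * d + 2 ≤ 2 * D'.card) : (decompSet K r d f).Infinite := by
  classical
  obtain ⟨a, ha⟩ := mem_decompSpan_iff.1 hD.1
  refine decompSet_infinite_of_replace hD ha hD' ?_
  obtain ⟨Y, hY, rfl⟩ := h.exists_image_point hcurve
  obtain ⟨s, hs⟩ := h.exists_rep_eq
  have h1 : ∑ p ∈ Y.image h.point, a p • powForm K r d p = ∑ y ∈ Y,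
      (a (h.point y) * s y ^ d) • linForm K r (∑ k ∈ Finset.range (e + 1), y ^ k • c k) ^ d := by
    rw [Finset.sum_image h.point_injective.injOn]
    refine Finset.sum_congr rfl fun y _ => ?_
    rw [powForm_eq, (hs y).2, map_smul, smul_pow, smul_smul]
  rw [h1]
  have hinf := infinite_evalSum_representations (e * d) Y (fun y => a (h.point y) * s y ^ d)
    (by omega)
  refine Set.infinite_of_injOn_mapsTo (f := fun Y' => Y'.image h.point) ?_ ?_ hinf
  · intro Y₁ _ Y₂ _ h12
    exact Finset.image_injective h.point_injective h12
  · rintro Y' ⟨hY', b, hb⟩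
    refine ⟨?_, ?_⟩
    · rw [← hY, ← hY']
      exact Finset.card_image_le
    · have := sum_linForm_pow_eq_of_moments (r := r) (c := c) (κ := 0) (e := e) (d := d) (Y := Y)
        (Z := Y') (a := fun y => a (h.point y) * s y ^ d) (b := b)
        (fun q hq => by rw [hb q hq]; ring)
      rw [this, zero_smul, add_zero]
      exact h.sum_linForm_pow_mem Y' b

end Curves

section Replacement

theorem LinearIndependent.exists_dual_family {K V ι : Type*} [Field K] [AddCommGroup V]
    [Module K V] [DecidableEq ι] {v : ι → V} (hv : LinearIndependent K v) :
    ∃ m : ι → Module.Dual K V, ∀ i j, m i (v j) = if j = i then 1 else 0 := by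
  obtain ⟨g, hg⟩ := (Finsupp.linearCombination K v).exists_leftInverse_of_injective
    (LinearMap.ker_eq_bot.2 hv)
  refine ⟨fun i => Finsupp.lapply i ∘ₗ g, fun i j => ?_⟩
  have h1 : g (v j) = Finsupp.single j 1 := by
    have := LinearMap.congr_fun hg (Finsupp.single j 1)
    simpa using this
  simp [h1, Finsupp.single_apply]

theorem smul_add_smul_eq_of_ne_zero {K V : Type*} [Field K] [AddCommGroup V] [Module K V] (P Q : V)
    {a b α β : K} (ha : a ≠ 0) (h : α * a + β * b ≠ 0) :
    α • P + β • Q = ((α * a + β * b) / a) • (P + (β / (α * a + β * b)) • (a • Q - b • P)) := by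
  match_scalars
  · field_simp
    ring
  · field_simp

theorem linearIndependent_smul_sub_smul {K V : Type*} [Field K] [AddCommGroup V] [Module K V]
    {P Q : V} (h : LinearIndependent K ![P, Q]) {a b : K} (ha : a ≠ 0) :
    LinearIndependent K ![P, a • Q - b • P] := by
  refine LinearIndependent.pair_iff.2 fun s t hst => ?_
  obtain ⟨h2, h3⟩ := LinearIndependent.pair_iff.1 h (s - t * b) (t * a) (by rw [← hst]; module)
  have ht : t = 0 := (mul_eq_zero.1 h3).resolve_right ha
  exact ⟨by simpa [ht] using h2, ht⟩

variable {K : Type} [Field K] {r d : ℕ}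

/-- An affine parametrization of the line spanned by two vectors. -/
theorem exists_isAffineParam_line {u v : Fin (r + 1) → K} (huv : LinearIndependent K ![u, v]) :
    ∃ l₀ l₁, IsAffineParam (fun y : K => ∑ k ∈ Finset.range (1 + 1),
      y ^ k • (if k = 0 then u else v)) l₀ l₁ := by
  obtain ⟨m, hm⟩ := huv.exists_dual_family
  have h00 := hm 0 0
  have h01 := hm 0 1
  have h10 := hm 1 0
  have h11 := hm 1 1
  simp at h00 h01 h10 h11
  exact ⟨m 0, m 1, fun y => by simp [Finset.sum_range_succ, h00, h01],
    fun y => by simp [Finset.sum_range_succ, h10, h11]⟩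

theorem Projectivization.linearIndependent_rep_pair {p q : Projectivization K (Fin (r + 1) → K)}
    (h : p ≠ q) : LinearIndependent K ![p.rep, q.rep] :=
  linearIndependent_pair_of_ne (x := Projectivization.rep)
    Projectivization.rep_nonzero Projectivization.eq_of_rep_mem_span_rep h

theorem decompSet_infinite_of_line [IsAlgClosed K] {f : MvPolynomial (Fin (r + 1)) K} (hd : 1 ≤ d)
    {W : Submodule K (Fin (r + 1) → K)} (hW : Module.finrank K W ≤ 2)
    {D D' : Finset (Projectivization K (Fin (r + 1) → K))} (hD : D ∈ decompSet K r d f)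
    (hD' : D' ⊆ D) (hDW : ∀ p ∈ D', p.rep ∈ W) (hcard : d + 2 ≤ 2 * D'.card) :
    (decompSet K r d f).Infinite := by
  obtain ⟨p₁, hp₁, p₂, hp₂, hne⟩ := Finset.one_lt_card.1 (by omega : 1 < D'.card)
  obtain ⟨l, -, hl⟩ := exists_dual_vanishing_ne_zero Projectivization.rep D'
    (⊥ : Submodule K (Fin (r + 1) → K))
  have hl' : ∀ p ∈ D', l p.rep ≠ 0 := fun p hp => hl p hp (by simpa using p.rep_nonzero)
  have h12 := Projectivization.linearIndependent_rep_pair hne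
  have hW₁ := hDW _ hp₁
  have hW₂ := hDW _ hp₂
  have hspan := span_pair_eq_of_finrank_le_two h12 hW hW₁ hW₂
  have hl1 := hl' _ hp₁
  have hli : LinearIndependent K
      ![p₁.rep, l p₁.rep • p₂.rep - l p₂.rep • p₁.rep] :=
    linearIndependent_smul_sub_smul h12 hl1
  obtain ⟨l₀, l₁, hpar⟩ := exists_isAffineParam_line hli
  refine decompSet_infinite_of_param 1 (fun k => if k = 0 then p₁.rep else
    l p₁.rep • p₂.rep - l p₂.rep • p₁.rep) hpar hD hD' (fun p hp => ?_) (by rwa [one_mul])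
  have hp' := hDW p hp
  rw [← hspan, Submodule.mem_span_pair] at hp'
  obtain ⟨α, β, hαβ⟩ := hp'
  have hlp : α * l p₁.rep + β * l p₂.rep ≠ 0 := by
    have := hl' p hp
    rwa [← hαβ, map_add, map_smul, map_smul, smul_eq_mul, smul_eq_mul] at this
  refine ⟨β / (α * l p₁.rep + β * l p₂.rep), (α * l p₁.rep + β * l p₂.rep) / l p₁.rep, ?_⟩
  rw [← hαβ]
  rw [smul_add_smul_eq_of_ne_zero p₁.rep p₂.rep hl1 hlp]
  congr 1
  simp [Finset.sum_range_succ]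

end Replacement

section Conic

section Abstract

variable {K V : Type*} [Field K] [AddCommGroup V] [Module K V]

theorem exists_conic_point_eq_smul (P Q R : V) {α β γ a b c : K} (hβ : β ≠ 0) (hγ : γ ≠ 0)
    (h : α * b * c + β * a * c + γ * a * b = 0) (hs : γ * b + β * c ≠ 0) :
    ∃ y s : K, a • P + b • Q + c • R =
      s • (-(β • Q) + y • (-(α • P) - β • Q + γ • R) + y ^ 2 • -(α • P)) := by
  refine ⟨-(β * c) / (γ * b + β * c), -(γ * b + β * c) / (β * γ), ?_⟩
  have h' : a * (γ * b + β * c) = -(α * b * c) := by linear_combination h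
  rw [← eq_div_iff hs] at h'
  have hb : γ * b = (γ * b + β * c) - β * c := by ring
  subst h'
  generalize γ * b + β * c = s at hs hb
  match_scalars
  · field_simp
    linear_combination (-α * c) * hb
  · field_simp
    linear_combination hb
  · field_simp

theorem bilin_combination (B : LinearMap.BilinForm K V) {P Q R : V} (hP : B P P = 0)
    (hQ : B Q Q = 0) (hR : B R R = 0) (a b c : K) :
    B (a • P + b • Q + c • R) (a • P + b • Q + c • R) =
      (B Q R + B R Q) * b * c + (B P R + B R P) * a * c + (B P Q + B Q P) * a * b := by
  simp only [map_add, map_smul, LinearMap.add_apply, LinearMap.smul_apply, smul_eq_mul, hP, hQ, hR]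
  ring

theorem linearIndependent_triple {P Q R : V} (hQR : LinearIndependent K ![Q, R])
    (hP : P ∉ Submodule.span K {Q, R}) : LinearIndependent K ![P, Q, R] := by
  refine linearIndependent_finCons.2 ⟨hQR, ?_⟩
  rwa [Matrix.range_cons_cons_empty]

theorem exists_eq_combination_of_finrank_le_three [FiniteDimensional K V] {P Q R v : V}
    (h : LinearIndependent K ![P, Q, R]) {W : Submodule K V} (hW : Module.finrank K W ≤ 3)
    (hP : P ∈ W) (hQ : Q ∈ W) (hR : R ∈ W) (hv : v ∈ W) :
    ∃ a b c : K, v = a • P + b • Q + c • R := by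
  have h1 := finrank_span_eq_card h
  have h2 : Submodule.span K (Set.range ![P, Q, R]) = W := by
    refine Submodule.eq_of_le_of_finrank_le (Submodule.span_le.2 ?_)
      (by rw [h1]; simpa using hW)
    rintro _ ⟨i, rfl⟩
    fin_cases i <;> simp [hP, hQ, hR]
  rw [← h2] at hv
  obtain ⟨c, hc⟩ := (Submodule.mem_span_range_iff_exists_fun K).1 hv
  exact ⟨c 0, c 1, c 2, by rw [← hc]; simp [Fin.sum_univ_three]⟩

end Abstract

variable {K : Type} [Field K] {r d : ℕ}

/-- An affine parametrization of a conic through three points. -/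
theorem exists_isAffineParam_conic {P Q R : Fin (r + 1) → K}
    (h : LinearIndependent K ![P, Q, R]) (α : K) {β γ : K} (hβ : β ≠ 0) (hγ : γ ≠ 0) :
    ∃ l₀ l₁, IsAffineParam (fun y : K => ∑ k ∈ Finset.range (2 + 1),
      y ^ k • (if k = 0 then -(β • Q) else if k = 1 then -(α • P) - β • Q + γ • R
        else -(α • P))) l₀ l₁ := by
  obtain ⟨m, hm⟩ := h.exists_dual_family
  have h10 : m 1 P = 0 := by simpa using hm 1 0
  have h11 : m 1 Q = 1 := by simpa using hm 1 1
  have h12 : m 1 R = 0 := by simpa using hm 1 2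
  have h20 : m 2 P = 0 := by simpa using hm 2 0
  have h21 : m 2 Q = 0 := by simpa using hm 2 1
  have h22 : m 2 R = 1 := by simpa using hm 2 2
  refine ⟨-β⁻¹ • m 1 - γ⁻¹ • m 2, γ⁻¹ • m 2, fun y => ?_, fun y => ?_⟩
  · simp [Finset.sum_range_succ, h10, h11, h12, h20, h21, h22]
    field_simp
    ring
  · simp [Finset.sum_range_succ, h20, h21, h22]
    field_simp

open Classical in
theorem decompSet_infinite_of_conic [IsAlgClosed K] {f : MvPolynomial (Fin (r + 1)) K}
    {W : Submodule K (Fin (r + 1) → K)} (hW : Module.finrank K W ≤ 3)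
    {Γ : Finset (Projectivization K (Fin (r + 1) → K))} (hΓ : ∀ p ∈ Γ, p.rep ∈ W)
    (hcardΓ : 5 ≤ Γ.card)
    (hGP : ∀ U : Submodule K (Fin (r + 1) → K), Module.finrank K U ≤ 2 →
      (Γ.filter fun p => p.rep ∈ U).card ≤ 2)
    {B : LinearMap.BilinForm K (Fin (r + 1) → K)} (hB : ∀ p ∈ Γ, B p.rep p.rep = 0)
    {w : Fin (r + 1) → K} (hw : w ∈ W) (hBw : B w w ≠ 0)
    {D D' : Finset (Projectivization K (Fin (r + 1) → K))} (hD : D ∈ decompSet K r d f)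
    (hD' : D' ⊆ D) (hDΓ : D' ⊆ Γ) {p₁ : Projectivization K (Fin (r + 1) → K)} (hp₁ : p₁ ∈ Γ)
    (hp₁' : p₁ ∉ D') (hcard : d + 1 ≤ D'.card) : (decompSet K r d f).Infinite := by
  have hpolar : ∀ p ∈ Γ, ∀ q ∈ Γ, p ≠ q → B p.rep q.rep + B q.rep p.rep ≠ 0 := by
    intro p hp q hq hpq h0
    obtain ⟨U, hU, hUW⟩ := exists_line_of_conic_contains_line hW
      (Projectivization.linearIndependent_rep_pair hpq) (hΓ p hp) (hΓ q hq) hw (hB p hp) (hB q hq)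
      h0 hBw
    have h1 : Γ ⊆ (Γ.filter fun i => i.rep ∈ Submodule.span K {p.rep, q.rep}) ∪
        (Γ.filter fun i => i.rep ∈ U) := by
      intro i hi
      have := hUW i.rep (hΓ i hi) (hB i hi)
      simpa [hi] using this
    have h2 := Finset.card_le_card h1
    have h3 := Finset.card_union_le (Γ.filter fun i => i.rep ∈ Submodule.span K {p.rep, q.rep})
      (Γ.filter fun i => i.rep ∈ U)
    have h4 := hGP _ (finrank_span_pair_le p.rep q.rep)
    have h5 := hGP _ hU
    omega
  obtain ⟨p₂, hp₂, p₃, hp₃, h23⟩ := Finset.one_lt_card.1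
    (by rw [Finset.card_erase_of_mem hp₁]; omega : 1 < (Γ.erase p₁).card)
  obtain ⟨h12, hp₂⟩ := Finset.mem_erase.1 hp₂
  obtain ⟨h13, hp₃⟩ := Finset.mem_erase.1 hp₃
  have hli : LinearIndependent K ![p₁.rep, p₂.rep, p₃.rep] := by
    refine linearIndependent_triple (Projectivization.linearIndependent_rep_pair h23) fun hmem => ?_
    have h1 : ({p₁, p₂, p₃} : Finset _) ⊆
        Γ.filter fun i => i.rep ∈ Submodule.span K {p₂.rep, p₃.rep} := by
      intro i hi
      simp only [Finset.mem_insert, Finset.mem_singleton] at hi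
      rw [Finset.mem_filter]
      rcases hi with rfl | rfl | rfl
      · exact ⟨hp₁, hmem⟩
      · exact ⟨hp₂, Submodule.subset_span (by simp)⟩
      · exact ⟨hp₃, Submodule.subset_span (by simp)⟩
    have h2 := Finset.card_le_card h1
    have h3 := hGP _ (finrank_span_pair_le p₂.rep p₃.rep)
    rw [Finset.card_eq_three.2 ⟨p₁, p₂, p₃, h12.symm, h13.symm, h23, rfl⟩] at h2
    omega
  have hβ := hpolar p₁ hp₁ p₃ hp₃ h13.symm
  have hγ := hpolar p₁ hp₁ p₂ hp₂ h12.symm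
  have hα := hpolar p₂ hp₂ p₃ hp₃ h23
  obtain ⟨l₀, l₁, hpar⟩ := exists_isAffineParam_conic hli
    (B p₂.rep p₃.rep + B p₃.rep p₂.rep) hβ hγ
  refine decompSet_infinite_of_param 2 _ hpar hD hD' (fun p hp => ?_) (by omega)
  have hpΓ := hDΓ hp
  have hpW := hΓ p hpΓ
  have hW₁ := hΓ p₁ hp₁
  have hW₂ := hΓ p₂ hp₂
  have hW₃ := hΓ p₃ hp₃
  obtain ⟨a, b, c, habc⟩ := exists_eq_combination_of_finrank_le_three hli hW hW₁ hW₂ hW₃ hpW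
  have hB0 := hB p hpΓ
  rw [habc, bilin_combination B (hB p₁ hp₁) (hB p₂ hp₂) (hB p₃ hp₃)] at hB0
  by_cases hs : (B p₁.rep p₂.rep + B p₂.rep p₁.rep) * b +
      (B p₁.rep p₃.rep + B p₃.rep p₁.rep) * c = 0
  · exfalso
    have h1 : (B p₂.rep p₃.rep + B p₃.rep p₂.rep) * (b * c) = 0 := by
      linear_combination hB0 - a * hs
    have hbc : b = 0 ∧ c = 0 := by
      rcases mul_eq_zero.1 ((mul_eq_zero.1 h1).resolve_left hα) with h0 | h0
      · rw [h0, mul_zero, zero_add] at hs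
        exact ⟨h0, (mul_eq_zero.1 hs).resolve_left hβ⟩
      · rw [h0, mul_zero, add_zero] at hs
        exact ⟨(mul_eq_zero.1 hs).resolve_left hγ, h0⟩
    rw [hbc.1, hbc.2, zero_smul, zero_smul, add_zero, add_zero] at habc
    have : p = p₁ := Projectivization.eq_of_rep_mem_span_rep p₁ p
      (Submodule.mem_span_singleton.2 ⟨a, habc.symm⟩)
    exact hp₁' (this ▸ hp)
  · obtain ⟨y, s, hys⟩ := exists_conic_point_eq_smul p₁.rep p₂.rep p₃.rep hβ hγ hB0 hs
    refine ⟨y, s, (habc.trans hys).trans ?_⟩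
    congr 1
    simp [Finset.sum_range_succ]

end Conic

section TwoLines

theorem sum_mul_eval_sub_of_moments {K : Type*} [Field K] {d : ℕ} {Y Z : Finset K} {a b : K → K}
    {μ : K} (h : ∀ k < d, ∑ y ∈ Y, a y * y ^ k - ∑ y ∈ Z, b y * y ^ k = 0)
    (hd : ∑ y ∈ Y, a y * y ^ d - ∑ y ∈ Z, b y * y ^ d = μ) (q : Polynomial K)
    (hq : q.natDegree ≤ d) :
    ∑ y ∈ Y, a y * q.eval y - ∑ y ∈ Z, b y * q.eval y = μ * q.coeff d := by
  have key : ∀ (Y : Finset K) (a : K → K), ∑ y ∈ Y, a y * q.eval y =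
      ∑ k ∈ Finset.range (d + 1), q.coeff k * ∑ y ∈ Y, a y * y ^ k := by
    intro Y a
    simp_rw [Polynomial.eval_eq_sum_range' (Nat.lt_succ_of_le hq), Finset.mul_sum]
    rw [Finset.sum_comm]
    exact Finset.sum_congr rfl fun k _ => Finset.sum_congr rfl fun y _ => by ring
  rw [key, key, ← Finset.sum_sub_distrib, Finset.sum_range_succ, Finset.sum_eq_zero, zero_add,
    ← mul_sub, hd, mul_comm]
  intro k hk
  rw [← mul_sub, h k (Finset.mem_range.1 hk), mul_zero]

variable {K : Type} [Field K] {r d : ℕ}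

theorem IsAffineParam.sum_powForm_image [DecidableEq (Projectivization K (Fin (r + 1) → K))]
    {φ : K → Fin (r + 1) → K} {l₀ l₁ : Module.Dual K (Fin (r + 1) → K)}
    (h : IsAffineParam φ l₀ l₁) (a : Projectivization K (Fin (r + 1) → K) → K) :
    ∃ a' : K → K, ∀ Y : Finset K, ∑ p ∈ Y.image h.point, a p • powForm K r d p =
      ∑ y ∈ Y, a' y • linForm K r (φ y) ^ d := by
  obtain ⟨s, hs⟩ := h.exists_rep_eq
  refine ⟨fun y => a (h.point y) * s y ^ d, fun Y => ?_⟩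
  rw [Finset.sum_image h.point_injective.injOn]
  refine Finset.sum_congr rfl fun y _ => ?_
  rw [powForm_eq, (hs y).2, map_smul, smul_pow, smul_smul]

open Classical in
/-- A relation between points on two lines, meeting in a point outside them, can be deformed. -/
theorem infinite_setOf_replacement_on_two_lines [IsAlgClosed K] [CharZero K]
    {u₁ o u₂ : Fin (r + 1) → K} (hli : LinearIndependent K ![u₁, o, u₂])
    {A₁ B₁ A₂ B₂ : Finset (Projectivization K (Fin (r + 1) → K))}
    (hA₁ : ∀ p ∈ A₁, ∃ y s : K, p.rep = s • (u₁ + y • o))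
    (hB₁ : ∀ p ∈ B₁, ∃ y s : K, p.rep = s • (u₁ + y • o))
    (hA₂ : ∀ p ∈ A₂, ∃ y s : K, p.rep = s • (u₂ + y • o))
    (hB₂ : ∀ p ∈ B₂, ∃ y s : K, p.rep = s • (u₂ + y • o))
    (hcA₁ : d + 1 = 2 * A₁.card) (hcB₁ : d + 1 = 2 * B₁.card)
    (hcA₂ : d + 1 = 2 * A₂.card) (hcB₂ : d + 1 = 2 * B₂.card)
    (hne₁ : A₁ ≠ B₁) (hne₂ : A₂ ≠ B₂) {a b : Projectivization K (Fin (r + 1) → K) → K}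
    (hrel : ∑ p ∈ A₁, a p • powForm K r d p - ∑ p ∈ B₁, b p • powForm K r d p +
      (∑ p ∈ A₂, a p • powForm K r d p - ∑ p ∈ B₂, b p • powForm K r d p) = 0) :
    {D : Finset (Projectivization K (Fin (r + 1) → K)) | D.card ≤ A₁.card + A₂.card ∧
      ∑ p ∈ A₁, a p • powForm K r d p + ∑ p ∈ A₂, a p • powForm K r d p ∈
        decompSpan K r d ↑D}.Infinite := by
  obtain ⟨m, hm⟩ := hli.exists_dual_family
  have h00 : m 0 u₁ = 1 := by simpa using hm 0 0
  have h01 : m 0 o = 0 := by simpa using hm 0 1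
  have h02 : m 0 u₂ = 0 := by simpa using hm 0 2
  have h10 : m 1 u₁ = 0 := by simpa using hm 1 0
  have h11 : m 1 o = 1 := by simpa using hm 1 1
  have h12 : m 1 u₂ = 0 := by simpa using hm 1 2
  have h20 : m 2 u₁ = 0 := by simpa using hm 2 0
  have h21 : m 2 o = 0 := by simpa using hm 2 1
  have h22 : m 2 u₂ = 1 := by simpa using hm 2 2
  have hφ : ∀ u : Fin (r + 1) → K, ∀ y : K, u + y • o = ∑ k ∈ Finset.range (1 + 1),
      y ^ k • (if k = 0 then u else o) := by
    intro u y
    simp [Finset.sum_range_succ]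
  have P₁ : IsAffineParam (fun y => u₁ + y • o) (m 0) (m 1) :=
    ⟨fun y => by simp [h00, h01], fun y => by simp [h10, h11]⟩
  have P₂ : IsAffineParam (fun y => u₂ + y • o) (m 2) (m 1) :=
    ⟨fun y => by simp [h21, h22], fun y => by simp [h11, h12]⟩
  have hdisj : ∀ y z, P₁.point y ≠ P₂.point z := by
    intro y z hyz
    obtain ⟨t, ht⟩ := (Projectivization.mk_eq_mk_iff' K _ _ _ _).1 hyz
    have := congrArg (m 0) ht
    simp [h00, h01, h02] at this
  obtain ⟨Y₁, hcY₁, rfl⟩ := P₁.exists_image_point hA₁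
  obtain ⟨Z₁, hcZ₁, rfl⟩ := P₁.exists_image_point hB₁
  obtain ⟨Y₂, hcY₂, rfl⟩ := P₂.exists_image_point hA₂
  obtain ⟨Z₂, hcZ₂, rfl⟩ := P₂.exists_image_point hB₂
  obtain ⟨a₁, ha₁⟩ := P₁.sum_powForm_image (d := d) a
  obtain ⟨b₁, hb₁⟩ := P₁.sum_powForm_image (d := d) b
  obtain ⟨a₂, ha₂⟩ := P₂.sum_powForm_image (d := d) a
  obtain ⟨b₂, hb₂⟩ := P₂.sum_powForm_image (d := d) b
  rw [← hcY₁] at hcA₁ ⊢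
  rw [← hcZ₁] at hcB₁
  rw [← hcY₂] at hcA₂ ⊢
  rw [← hcZ₂] at hcB₂
  replace hne₁ : Y₁ ≠ Z₁ := fun h => hne₁ (by rw [h])
  replace hne₂ : Y₂ ≠ Z₂ := fun h => hne₂ (by rw [h])
  rw [ha₁, hb₁, ha₂, hb₂] at hrel
  rw [ha₁, ha₂]
  have hmom : ∀ (n : Module.Dual K (Fin (r + 1) → K)) (k : ℕ), k ≤ d →
      (∑ y ∈ Y₁, a₁ y * (n (u₁ + y • o) ^ (d - k) * m 1 (u₁ + y • o) ^ k) -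
        ∑ y ∈ Z₁, b₁ y * (n (u₁ + y • o) ^ (d - k) * m 1 (u₁ + y • o) ^ k)) +
      (∑ y ∈ Y₂, a₂ y * (n (u₂ + y • o) ^ (d - k) * m 1 (u₂ + y • o) ^ k) -
        ∑ y ∈ Z₂, b₂ y * (n (u₂ + y • o) ^ (d - k) * m 1 (u₂ + y • o) ^ k)) = 0 := by
    intro n k hk
    obtain ⟨Φ, hΦ⟩ := exists_functional_linForm_pow
      (List.replicate (d - k) n ++ List.replicate k (m 1))
    have hlen : (List.replicate (d - k) n ++ List.replicate k (m 1)).length = d := by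
      simp only [List.length_append, List.length_replicate]
      omega
    rw [hlen] at hΦ
    have := congrArg Φ hrel
    simp only [List.map_append, List.map_replicate, List.prod_append, List.prod_replicate] at hΦ
    rw [Φ.map_add, Φ.map_sub, Φ.map_sub, map_sum Φ, map_sum Φ, map_sum Φ, map_sum Φ,
      Φ.map_zero] at this
    simpa only [Φ.map_smul, hΦ, smul_eq_mul] using this
  have hmd := hmom 0 d le_rfl
  have hm₁ : ∀ k < d, ∑ y ∈ Y₁, a₁ y * y ^ k - ∑ y ∈ Z₁, b₁ y * y ^ k = 0 := by
    intro k hk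
    have := hmom (m 0) k hk.le
    simpa [h00, h01, h02, h10, h11, h12, Nat.sub_ne_zero_of_lt hk] using this
  have hm₂ : ∀ k < d, ∑ y ∈ Y₂, a₂ y * y ^ k - ∑ y ∈ Z₂, b₂ y * y ^ k = 0 := by
    intro k hk
    have := hmom (m 2) k hk.le
    simpa [h20, h21, h22, h10, h11, h12, Nat.sub_ne_zero_of_lt hk] using this
  simp only [Nat.sub_self, pow_zero, one_mul, map_add, map_smul, h10, h11, h12, zero_add,
    smul_eq_mul, mul_one] at hmd
  obtain ⟨μ, hμ⟩ : ∃ μ, ∑ y ∈ Y₁, a₁ y * y ^ d - ∑ y ∈ Z₁, b₁ y * y ^ d = μ := ⟨_, rfl⟩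
  have hμ' : ∑ y ∈ Y₂, a₂ y * y ^ d - ∑ y ∈ Z₂, b₂ y * y ^ d = -μ := by
    rw [← hμ]
    linear_combination hmd
  obtain ⟨hF₁, hG₁⟩ := finite_setOf_not_pencil_representation d Y₁ Z₁ a₁ b₁ μ hcA₁ (by omega) hne₁
    (sum_mul_eval_sub_of_moments hm₁ hμ)
  obtain ⟨hF₂, -⟩ := finite_setOf_not_pencil_representation d Y₂ Z₂ a₂ b₂ (-μ) hcA₂ (by omega) hne₂
    (sum_mul_eval_sub_of_moments hm₂ hμ')
  have hinf := (hF₁.union hF₂).infinite_compl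
  generalize hS : (_ ∪ _ : Set K)ᶜ = S at hinf
  have hex : ∀ l ∈ S, ∃ Y₁' Y₂' : Finset K, Y₁'.card = Y₁.card ∧ Y₂'.card = Y₂.card ∧
      ∏ y ∈ Y₁', (Polynomial.X - Polynomial.C y) = ∏ y ∈ Y₁, (Polynomial.X - Polynomial.C y) +
        Polynomial.C l * (∏ y ∈ Z₁, (Polynomial.X - Polynomial.C y) -
          ∏ y ∈ Y₁, (Polynomial.X - Polynomial.C y)) ∧
      ∑ y ∈ Y₁, a₁ y • linForm K r (u₁ + y • o) ^ d +
        ∑ y ∈ Y₂, a₂ y • linForm K r (u₂ + y • o) ^ d ∈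
          decompSpan K r d ↑(Y₁'.image P₁.point ∪ Y₂'.image P₂.point) := by
    intro l hl
    rw [← hS] at hl
    obtain ⟨hl₁, hl₂⟩ := not_or.1 hl
    obtain ⟨Y₁', hc₁, hp₁, c₁, hr₁⟩ := not_not.1 hl₁
    obtain ⟨Y₂', hc₂, -, c₂, hr₂⟩ := not_not.1 hl₂
    refine ⟨Y₁', Y₂', hc₁, hc₂, hp₁, ?_⟩
    have e₁ := sum_linForm_pow_eq_of_moments (r := r) (e := 1) (d := d)
      (c := fun k => if k = 0 then u₁ else o) (κ := l * μ) (by rwa [one_mul])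
    have e₂ := sum_linForm_pow_eq_of_moments (r := r) (e := 1) (d := d)
      (c := fun k => if k = 0 then u₂ else o) (κ := l * -μ) (by rwa [one_mul])
    simp only [← hφ] at e₁ e₂
    have e₃ : ∀ x y z : MvPolynomial (Fin (r + 1)) K,
        x + (l * μ) • z + (y + (l * -μ) • z) = x + y := fun x y z => by module
    rw [e₁, e₂]
    simp only [one_ne_zero, if_false]
    rw [e₃]
    refine Submodule.add_mem _ ?_ ?_
    · exact Submodule.span_mono (Set.image_mono (by simp)) (P₁.sum_linForm_pow_mem Y₁' c₁)
    · exact Submodule.span_mono (Set.image_mono (by simp)) (P₂.sum_linForm_pow_mem Y₂' c₂)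
  choose! Φ Ψ hΦ hΨ hprod hmem using hex
  refine Set.infinite_of_injOn_mapsTo
    (f := fun l => (Φ l).image P₁.point ∪ (Ψ l).image P₂.point) ?_ ?_ hinf
  · intro l hl l' hl' hll
    have h1 : Φ l = Φ l' := by
      ext y
      have h2 : ∀ l, y ∈ Φ l ↔ P₁.point y ∈ (Φ l).image P₁.point ∪ (Ψ l).image P₂.point := by
        intro l
        rw [Finset.mem_union, P₁.point_injective.mem_finset_image, Finset.mem_image, or_iff_left]
        rintro ⟨z, -, hz⟩
        exact hdisj y z hz.symm
      rw [h2, h2]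
      exact Finset.ext_iff.1 hll _
    have h2 := hprod l hl
    rw [h1, hprod l' hl', add_right_inj] at h2
    exact (Polynomial.C_injective (mul_right_cancel₀ hG₁ h2)).symm
  · intro l hl
    refine ⟨(Finset.card_union_le _ _).trans ?_, hmem l hl⟩
    rw [Finset.card_image_of_injective _ P₁.point_injective,
      Finset.card_image_of_injective _ P₂.point_injective, hΦ l hl, hΨ l hl]

end TwoLines

section Assembly

theorem exists_projection_of_disjoint {K V : Type*} [Field K] [AddCommGroup V] [Module K V]
    {W₁ W₂ : Submodule K V} (h : Disjoint W₁ W₂) :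
    ∃ π : V →ₗ[K] V, (∀ v ∈ W₁, π v = v) ∧ ∀ v ∈ W₂, π v = 0 := by
  obtain ⟨g, hg⟩ := (W₂.mkQ ∘ₗ W₁.subtype).exists_leftInverse_of_injective (by
    rw [LinearMap.ker_eq_bot']
    intro v hv
    have hv₂ : (v : V) ∈ W₂ := by simpa using hv
    exact Subtype.ext (Submodule.disjoint_def.1 h _ v.2 hv₂))
  refine ⟨W₁.subtype ∘ₗ g ∘ₗ W₂.mkQ, fun v hv => ?_, fun v hv => ?_⟩
  · exact congrArg Subtype.val (LinearMap.congr_fun hg ⟨v, hv⟩)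
  · simp [(Submodule.Quotient.mk_eq_zero W₂).2 hv]

theorem CayleyBacharach.of_disjoint_lines {K V ι : Type*} [Field K] [AddCommGroup V] [Module K V]
    {x : ι → V} {d : ℕ} (hd : d ≠ 0) {E E₁ : Finset ι} (h : CayleyBacharach K x d E)
    {W₁ W₂ : Submodule K V} (hW : Disjoint W₁ W₂) (hE₁ : E₁ ⊆ E) (h₁ : ∀ i ∈ E₁, x i ∈ W₁)
    (h₂ : ∀ i ∈ E, i ∉ E₁ → x i ∈ W₂) : CayleyBacharach K x d E₁ := by
  classical
  obtain ⟨c, hc, hrel⟩ := h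
  obtain ⟨π, hπ₁, hπ₂⟩ := exists_projection_of_disjoint hW
  refine ⟨c, fun i hi => hc i (hE₁ hi), fun L hL => ?_⟩
  have h0 := hrel (L.map fun l => l ∘ₗ π) (by simpa using hL)
  rw [← Finset.sum_sdiff hE₁, Finset.sum_eq_zero, zero_add] at h0
  · rw [← h0]
    refine Finset.sum_congr rfl fun i hi => ?_
    simp [List.map_map, Function.comp_def, hπ₁ _ (h₁ i hi)]
  · intro i hi
    rw [Finset.mem_sdiff] at hi
    simp [List.map_map, Function.comp_def, hπ₂ _ (h₂ i hi.1 hi.2), hL, hd]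

theorem exists_eq_smul_add_smul {K V : Type*} [Field K] [AddCommGroup V] [Module K V]
    [FiniteDimensional K V] {W₁ W₂ : Submodule K V} (hW₁ : Module.finrank K W₁ ≤ 2) {u o v : V}
    (huo : LinearIndependent K ![u, o]) (hu : u ∈ W₁) (ho₁ : o ∈ W₁) (ho₂ : o ∈ W₂) (hv₁ : v ∈ W₁)
    (hv₂ : v ∉ W₂) : ∃ y s : K, v = s • (u + y • o) := by
  rw [← span_pair_eq_of_finrank_le_two huo hW₁ hu ho₁, Submodule.mem_span_pair] at hv₁
  obtain ⟨α, β, rfl⟩ := hv₁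
  have hα : α ≠ 0 := by
    rintro rfl
    exact hv₂ (by simpa using W₂.smul_mem β ho₂)
  exact ⟨β / α, α, by rw [smul_add, smul_smul, mul_div_cancel₀ _ hα]⟩

theorem linearIndependent_pair_of_notMem {K V : Type*} [Field K] [AddCommGroup V] [Module K V]
    {W : Submodule K V} {o v : V} (ho : o ∈ W) (ho0 : o ≠ 0) (hv : v ∉ W) :
    LinearIndependent K ![v, o] := by
  refine LinearIndependent.pair_iff.2 fun s t hst => ?_
  have hs : s = 0 := by
    by_contra hs
    refine hv ((W.smul_mem_iff hs).1 ?_)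
    rw [eq_neg_of_add_eq_zero_left hst]
    exact W.neg_mem (W.smul_mem _ ho)
  exact ⟨hs, by simpa [hs, ho0] using hst⟩

variable {K : Type} [Field K] {r d : ℕ} {f : MvPolynomial (Fin (r + 1)) K}
  {A B E : Finset (Projectivization K (Fin (r + 1) → K))}

theorem ne_zero_of_mem_decompSet (hA : A ∈ decompSet K r d f)
    {a : Projectivization K (Fin (r + 1) → K) → K} (ha : ∑ p ∈ A, a p • powForm K r d p = f)
    {p : Projectivization K (Fin (r + 1) → K)} (hp : p ∈ A) : a p ≠ 0 := by
  classical
  intro h0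
  have h1 : f ∈ decompSpan K r d ↑(A.erase p) := by
    rw [mem_decompSpan_iff]
    refine ⟨a, ?_⟩
    rw [← ha, ← Finset.add_sum_erase A _ hp, h0, zero_smul, zero_add]
  have h2 := symRank_le h1
  have h3 := hA.2
  have h4 := Finset.card_erase_lt_of_mem hp
  omega

/-- The relation between the powers of linear forms in two different decompositions. -/
theorem exists_relation_of_decompSet (hA : A ∈ decompSet K r d f) (hB : B ∈ decompSet K r d f)
    (hAB : A ≠ B) {a : Projectivization K (Fin (r + 1) → K) → K}
    (ha : ∑ p ∈ A, a p • powForm K r d p = f) :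
    ∃ (E : Finset (Projectivization K (Fin (r + 1) → K)))
      (c : Projectivization K (Fin (r + 1) → K) → K),
      (∀ p ∈ E, p ∈ A ∨ p ∈ B) ∧ (∃ p ∈ E, p ∉ B) ∧ (∃ p ∈ E, p ∉ A) ∧ (∀ p ∈ E, c p ≠ 0) ∧
      (∀ p ∈ A, p ∉ B → c p = a p) ∧ ∑ p ∈ E, c p • powForm K r d p = 0 := by
  classical
  obtain ⟨b, hb⟩ := mem_decompSpan_iff.1 hB.1
  let c : Projectivization K (Fin (r + 1) → K) → K :=
    fun p => (if p ∈ A then a p else 0) - (if p ∈ B then b p else 0)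
  have hcard : A.card = B.card := hA.2.trans hB.2.symm
  have hcA : ∀ p ∈ A, p ∉ B → c p = a p := fun p hp hp' => by simp [c, hp, hp']
  have hcB : ∀ p ∈ B, p ∉ A → c p = -b p := fun p hp hp' => by simp [c, hp, hp']
  refine ⟨(A ∪ B).filter fun p => c p ≠ 0, c, ?_, ?_, ?_, ?_, hcA, ?_⟩
  · intro p hp
    exact Finset.mem_union.1 (Finset.mem_filter.1 hp).1
  · have h1 : ¬ A ⊆ B := fun h => hAB (Finset.eq_of_subset_of_card_le h hcard.ge)
    obtain ⟨p, hp, hp'⟩ := Finset.not_subset.1 h1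
    refine ⟨p, Finset.mem_filter.2 ⟨Finset.mem_union_left _ hp, ?_⟩, hp'⟩
    rw [hcA p hp hp']
    exact ne_zero_of_mem_decompSet hA ha hp
  · have h1 : ¬ B ⊆ A := fun h => hAB (Finset.eq_of_subset_of_card_le h hcard.le).symm
    obtain ⟨p, hp, hp'⟩ := Finset.not_subset.1 h1
    refine ⟨p, Finset.mem_filter.2 ⟨Finset.mem_union_right _ hp, ?_⟩, hp'⟩
    rw [hcB p hp hp']
    exact neg_ne_zero.2 (ne_zero_of_mem_decompSet hB hb hp)
  · intro p hp
    exact (Finset.mem_filter.1 hp).2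
  · have h1 : ∑ p ∈ A ∪ B, c p • powForm K r d p = 0 := by
      simp only [c, sub_smul, ite_smul, zero_smul, Finset.sum_sub_distrib, Finset.sum_ite_mem]
      rw [Finset.union_inter_cancel_left, Finset.union_inter_cancel_right, ha, hb, sub_self]
    rw [← h1]
    refine Finset.sum_subset (Finset.filter_subset _ _) fun p hp hp' => ?_
    have : c p = 0 := by
      by_contra h
      exact hp' (Finset.mem_filter.2 ⟨hp, h⟩)
    rw [this, zero_smul]

theorem cayleyBacharach_of_relation [CharZero K]
    {c : Projectivization K (Fin (r + 1) → K) → K} (hc : ∀ p ∈ E, c p ≠ 0)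
    (h : ∑ p ∈ E, c p • powForm K r d p = 0) :
    CayleyBacharach K Projectivization.rep d E := by
  refine ⟨c, hc, fun L hL => ?_⟩
  subst hL
  exact sum_mul_prod_eq_zero_of_sum_linForm_pow L c h

end Assembly

section TwoLinesCase

variable {K : Type} [Field K] {r d : ℕ} {f : MvPolynomial (Fin (r + 1)) K}
  {A B E : Finset (Projectivization K (Fin (r + 1) → K))}

open Classical in
/-- If finitely many decompositions exist, two of them have few points on a line, and they are
balanced if equality holds. -/
theorem card_le_of_line_of_not_infinite [IsAlgClosed K] (hd : 1 ≤ d)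
    (hA : A ∈ decompSet K r d f) (hB : B ∈ decompSet K r d f)
    (hfin : ¬ (decompSet K r d f).Infinite)
    {W : Submodule K (Fin (r + 1) → K)} (hW : Module.finrank K W ≤ 2)
    (hE : ∀ p ∈ E, p ∈ A ∨ p ∈ B) (hEW : ∀ p ∈ E, p.rep ∈ W) :
    E.card ≤ d + 1 ∧ (E.card = d + 1 → d + 1 = 2 * (E ∩ A).card ∧ d + 1 = 2 * (E ∩ B).card ∧
      Disjoint (E ∩ A) (E ∩ B)) := by
  have h : ∀ D ∈ decompSet K r d f, 2 * (E ∩ D).card ≤ d + 1 := by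
    intro D hD
    by_contra hlt
    exact hfin (decompSet_infinite_of_line hd hW hD Finset.inter_subset_right
      (fun p hp => hEW p (Finset.mem_inter.1 hp).1) (by omega))
  have hA' := h A hA
  have hB' := h B hB
  have h1 : E ∩ A ∪ E ∩ B = E := by
    ext p
    simp only [Finset.mem_union, Finset.mem_inter]
    exact ⟨by tauto, fun hp => by have := hE p hp; tauto⟩
  have h2 := Finset.card_union_add_card_inter (E ∩ A) (E ∩ B)
  rw [h1] at h2
  refine ⟨by omega, fun hc => ⟨by omega, by omega, ?_⟩⟩
  rw [Finset.disjoint_iff_inter_eq_empty, ← Finset.card_eq_zero]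
  omega

theorem decompSet_infinite_of_two_lines [IsAlgClosed K] [CharZero K] (hd : 1 ≤ d)
    (hA : A ∈ decompSet K r d f) (hB : B ∈ decompSet K r d f)
    {a c : Projectivization K (Fin (r + 1) → K) → K} (ha : ∑ p ∈ A, a p • powForm K r d p = f)
    (hE : ∀ p ∈ E, p ∈ A ∨ p ∈ B) (hne : E.Nonempty) (hc : ∀ p ∈ E, c p ≠ 0)
    (hca : ∀ p ∈ A, p ∉ B → c p = a p) (hrel : ∑ p ∈ E, c p • powForm K r d p = 0)
    {W₁ W₂ : Submodule K (Fin (r + 1) → K)} (hW₁ : Module.finrank K W₁ ≤ 2)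
    (hW₂ : Module.finrank K W₂ ≤ 2) (hEW : ∀ p ∈ E, p.rep ∈ W₁ ∨ p.rep ∈ W₂) :
    (decompSet K r d f).Infinite := by
  classical
  by_contra hfin
  have hCB := cayleyBacharach_of_relation hc hrel
  have hcard : ∀ {n : ℕ} {Γ : Finset (Projectivization K (Fin (r + 1) → K))},
      CayleyBacharach K Projectivization.rep n Γ → Γ.Nonempty → n + 2 ≤ Γ.card :=
    fun h h' => h.add_two_le_card Projectivization.rep_nonzero
      Projectivization.eq_of_rep_mem_span_rep h'
  have hstep : ∀ W W' : Submodule K (Fin (r + 1) → K), Module.finrank K W ≤ 2 →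
      Module.finrank K W' ≤ 2 → (∀ p ∈ E, p.rep ∈ W ∨ p.rep ∈ W') →
      (E.filter fun p => p.rep ∉ W') = (E.filter fun p => p.rep ∈ W) ∧
      (E.filter fun p => p.rep ∈ W).card = d + 1 := by
    intro W W' hW hW' hWW'
    have hsub : (E.filter fun p => p.rep ∉ W') ⊆ E.filter fun p => p.rep ∈ W := by
      intro p hp
      rw [Finset.mem_filter] at hp ⊢
      exact ⟨hp.1, (hWW' p hp.1).resolve_right hp.2⟩
    have h1 : (E.filter fun p => p.rep ∉ W').Nonempty := by
      by_contra h0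
      rw [Finset.not_nonempty_iff_eq_empty, Finset.filter_eq_empty_iff] at h0
      have h2 := (card_le_of_line_of_not_infinite hd hA hB hfin hW' hE
        (fun p hp => not_not.1 (h0 hp))).1
      have h3 := hcard hCB hne
      omega
    obtain ⟨n, rfl⟩ : ∃ n, d = n + 1 := ⟨d - 1, by omega⟩
    have h2 := hcard (hCB.diff W') h1
    have h3 := (card_le_of_line_of_not_infinite (E := E.filter fun p => p.rep ∈ W) hd hA hB hfin hW
      (fun p hp => hE p (Finset.mem_filter.1 hp).1) (fun p hp => (Finset.mem_filter.1 hp).2)).1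
    have h4 := Finset.card_le_card hsub
    exact ⟨Finset.eq_of_subset_of_card_le hsub (by omega), by omega⟩
  obtain ⟨hN₁, hc₁⟩ := hstep W₁ W₂ hW₁ hW₂ hEW
  obtain ⟨hN₂, hc₂⟩ := hstep W₂ W₁ hW₂ hW₁ fun p hp => (hEW p hp).symm
  set E₁ := E.filter fun p => p.rep ∈ W₁ with hE₁
  set E₂ := E.filter fun p => p.rep ∈ W₂ with hE₂
  have m₁ : ∀ p ∈ E₁, p ∈ E ∧ p.rep ∈ W₁ ∧ p.rep ∉ W₂ := fun p hp =>
    ⟨(Finset.mem_filter.1 hp).1, (Finset.mem_filter.1 hp).2, by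
      rw [← hN₁] at hp
      exact (Finset.mem_filter.1 hp).2⟩
  have m₂ : ∀ p ∈ E₂, p ∈ E ∧ p.rep ∈ W₂ ∧ p.rep ∉ W₁ := fun p hp =>
    ⟨(Finset.mem_filter.1 hp).1, (Finset.mem_filter.1 hp).2, by
      rw [← hN₂] at hp
      exact (Finset.mem_filter.1 hp).2⟩
  obtain ⟨-, hb₁⟩ := card_le_of_line_of_not_infinite hd hA hB hfin hW₁
    (fun p hp => hE p (m₁ p hp).1) (fun p hp => (m₁ p hp).2.1)
  obtain ⟨-, hb₂⟩ := card_le_of_line_of_not_infinite hd hA hB hfin hW₂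
    (fun p hp => hE p (m₂ p hp).1) (fun p hp => (m₂ p hp).2.1)
  obtain ⟨hcA₁, hcB₁, hd₁⟩ := hb₁ hc₁
  obtain ⟨hcA₂, hcB₂, hd₂⟩ := hb₂ hc₂
  have hE₁ne : E₁.Nonempty := Finset.card_pos.1 (by omega)
  have hE₂ne : E₂.Nonempty := Finset.card_pos.1 (by omega)
  have hnd : ¬ Disjoint W₁ W₂ := by
    intro hdis
    have h1 := hCB.of_disjoint_lines (by omega) hdis (Finset.filter_subset _ _ : E₁ ⊆ E)
      (fun p hp => (m₁ p hp).2.1) (fun p hp hp' => (hEW p hp).resolve_left fun h =>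
        hp' (Finset.mem_filter.2 ⟨hp, h⟩))
    have h2 : d + 2 ≤ E₁.card := by convert hcard h1 hE₁ne
    omega
  obtain ⟨o, ho₁, ho₂, ho0⟩ : ∃ o ∈ W₁, o ∈ W₂ ∧ o ≠ 0 := by
    rw [Submodule.disjoint_def] at hnd
    push Not at hnd
    exact hnd
  obtain ⟨p₁, hp₁⟩ := hE₁ne
  obtain ⟨p₂, hp₂⟩ := hE₂ne
  obtain ⟨-, hu₁, hu₁'⟩ := m₁ p₁ hp₁
  obtain ⟨-, hu₂, hu₂'⟩ := m₂ p₂ hp₂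
  have hli₁ := linearIndependent_pair_of_notMem ho₂ ho0 hu₁'
  have hli₂ := linearIndependent_pair_of_notMem ho₁ ho0 hu₂'
  have hli : LinearIndependent K ![p₁.rep, o, p₂.rep] := by
    refine linearIndependent_triple (LinearIndependent.pair_symm_iff.1 hli₂) fun h => hu₁' ?_
    have hle : Submodule.span K {o, p₂.rep} ≤ W₂ :=
      Submodule.span_le.2 (by simp [Set.insert_subset_iff, ho₂, hu₂])
    exact hle h
  have hq₁ : ∀ p ∈ E₁, ∃ y s : K, p.rep = s • (p₁.rep + y • o) := by
    intro p hp
    obtain ⟨-, hv, hv'⟩ := m₁ p hp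
    exact exists_eq_smul_add_smul hW₁ hli₁ hu₁ ho₁ ho₂ hv hv'
  have hq₂ : ∀ p ∈ E₂, ∃ y s : K, p.rep = s • (p₂.rep + y • o) := by
    intro p hp
    obtain ⟨-, hv, hv'⟩ := m₂ p hp
    exact exists_eq_smul_add_smul hW₂ hli₂ hu₂ ho₂ ho₁ hv hv'
  have hEAB : ∀ E' ⊆ E, E' ∩ A ∪ E' ∩ B = E' := by
    intro E' hE'
    ext p
    simp only [Finset.mem_union, Finset.mem_inter]
    exact ⟨by tauto, fun hp => by have := hE p (hE' hp); tauto⟩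
  have hE12 : Disjoint E₁ E₂ :=
    Finset.disjoint_left.2 fun p hp hp' => (m₁ p hp).2.2 (m₂ p hp').2.1
  have hEE : E₁ ∪ E₂ = E := by
    ext p
    simp only [hE₁, hE₂, Finset.mem_union, Finset.mem_filter]
    exact ⟨by tauto, fun hp => by have := hEW p hp; tauto⟩
  have hne' : ∀ E' : Finset (Projectivization K (Fin (r + 1) → K)),
      d + 1 = 2 * (E' ∩ A).card → Disjoint (E' ∩ A) (E' ∩ B) → E' ∩ A ≠ E' ∩ B := by
    intro E' h1 h2 h3
    rw [← h3, disjoint_self, Finset.bot_eq_empty, ← Finset.card_eq_zero] at h2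
    omega
  have hinf := infinite_setOf_replacement_on_two_lines (d := d) hli
    (fun p hp => hq₁ p (Finset.mem_inter.1 hp).1) (fun p hp => hq₁ p (Finset.mem_inter.1 hp).1)
    (fun p hp => hq₂ p (Finset.mem_inter.1 hp).1) (fun p hp => hq₂ p (Finset.mem_inter.1 hp).1)
    hcA₁ hcB₁ hcA₂ hcB₂ (hne' E₁ hcA₁ hd₁) (hne' E₂ hcA₂ hd₂) (a := c) (b := fun p => -c p) (by
      simp only [neg_smul, Finset.sum_neg_distrib, sub_neg_eq_add]
      rw [← Finset.sum_union hd₁, ← Finset.sum_union hd₂, hEAB E₁ (Finset.filter_subset _ _),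
        hEAB E₂ (Finset.filter_subset _ _), ← Finset.sum_union hE12, hEE, hrel])
  have hdA : Disjoint (E₁ ∩ A) (E₂ ∩ A) :=
    hE12.mono Finset.inter_subset_left Finset.inter_subset_left
  refine hfin (decompSet_infinite_of_replace hA ha
    (Finset.union_subset Finset.inter_subset_right Finset.inter_subset_right :
      E₁ ∩ A ∪ E₂ ∩ A ⊆ A) ?_)
  have hsum : ∀ E' : Finset (Projectivization K (Fin (r + 1) → K)),
      Disjoint (E' ∩ A) (E' ∩ B) → ∑ p ∈ E' ∩ A, a p • powForm K r d p =
        ∑ p ∈ E' ∩ A, c p • powForm K r d p := by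
    intro E' h1
    refine Finset.sum_congr rfl fun p hp => ?_
    obtain ⟨hp', hpA⟩ := Finset.mem_inter.1 hp
    rw [hca p hpA fun hpB => Finset.disjoint_left.1 h1 hp (Finset.mem_inter.2 ⟨hp', hpB⟩)]
  rw [Finset.sum_union hdA, Finset.card_union_of_disjoint hdA, hsum E₁ hd₁, hsum E₂ hd₂]
  exact hinf

end TwoLinesCase

/-- if `sr f = t` with `2t < 3d`, `r ≥ 2`, and `f` has two distinct
decompositions, then `S(f)` is infinite. -/
theorem stmt_0 {K : Type} [Field K] [IsAlgClosed K] [CharZero K]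
    {r d t : ℕ} (hr : 2 ≤ r) (hd : 1 ≤ d) (ht : 0 < t) (htd : 2 * t < 3 * d)
    {f : MvPolynomial (Fin (r + 1)) K} (hf0 : f ≠ 0) (hfh : f.IsHomogeneous d)
    (hsr : symRank K r d f = t)
    {A B : Finset (Projectivization K (Fin (r + 1) → K))}
    (hA : A ∈ decompSet K r d f) (hB : B ∈ decompSet K r d f) (hAB : A ≠ B) :
    (decompSet K r d f).Infinite := by
  classical
  obtain ⟨a, ha⟩ := mem_decompSpan_iff.1 hA.1
  obtain ⟨E, c, hE, ⟨p, hp, hpB⟩, ⟨q, hq, hqA⟩, hc, hca, hrel⟩ :=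
    exists_relation_of_decompSet hA hB hAB ha
  have hCB := cayleyBacharach_of_relation hc hrel
  have hcA : A.card = t := hA.2.trans hsr
  have hcB : B.card = t := hB.2.trans hsr
  have hEsub : E ⊆ A ∪ B := fun p hp => Finset.mem_union.2 (hE p hp)
  have hEcard : E.card + 1 ≤ 3 * d := by
    have h1 := Finset.card_le_card hEsub
    have h2 := Finset.card_union_le A B
    omega
  obtain ⟨W₁, W₂, hW₁, hW₂, hEW⟩ | ⟨W, hW, hEW, hGP, Q, hQ, w, hw, hQw⟩ :=
    hCB.two_lines_or_conic Projectivization.rep_nonzero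
      Projectivization.eq_of_rep_mem_span_rep hEcard
  · exact decompSet_infinite_of_two_lines hd hA hB ha hE ⟨p, hp⟩ hc hca hrel hW₁ hW₂ hEW
  · have h1 : 2 * d + 2 ≤ E.card := hCB.two_mul_add_two_le_card Projectivization.rep_nonzero
      Projectivization.eq_of_rep_mem_span_rep ⟨p, hp⟩ hGP
    have h2 : E.card ≤ (E ∩ A).card + (E ∩ B).card := by
      have h3 := Finset.card_union_le (E ∩ A) (E ∩ B)
      rwa [← Finset.inter_union_distrib_left, Finset.inter_eq_left.2 hEsub] at h3
    have h5 : 5 ≤ E.card := by omega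
    have key : ∀ D ∈ decompSet K r d f, ∀ p₁ ∈ E, p₁ ∉ D → d + 1 ≤ (E ∩ D).card →
        (decompSet K r d f).Infinite := fun D hD p₁ hp₁ hp₁D hcard =>
      decompSet_infinite_of_conic hW hEW h5 hGP hQ hw hQw hD Finset.inter_subset_right
        Finset.inter_subset_left hp₁ (fun h => hp₁D (Finset.mem_inter.1 h).2) hcard
    rcases le_or_gt (d + 1) (E ∩ A).card with h | h
    · exact key A hA q hq hqA h
    · exact key B hB p hp hpB (by omega)
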